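/- arXiv:1404.5492 — 11 statements merged into one kernel-verified Lean document; each statement's English description precedes it below -/
import Mathlib

section
/- Let ξ, x, y be complex numbers such that sinh(x+y) ≠ 0 and sinh(x−y) ≠ 0. Then the signed sum over the four sign choices ε₁, ε₂ ∈ {+1, −1} of ε₁ε₂ · sinh(ξ+ε₁x)·sinh(ξ+ε₂y) / sinh(ε₁x+ε₂y) equals zero; explicitly, sinh(ξ+x)sinh(ξ+y)/sinh(x+y) − sinh(ξ+x)sinh(ξ−y)/sinh(x−y) − sinh(ξ−x)sinh(ξ+y)/sinh(y−x) + sinh(ξ−x)sinh(ξ−y)/sinh(−x−y) = 0. -/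
open Complex

/-- The four-term signed sum identity underlying the reflection equation for
Cherednik's diagonal K-matrix with the 6-vertex R-matrix. -/
theorem sinh_reflection_identity (ξ x y : ℂ)
    (hxy : sinh (x + y) ≠ 0) (hxy' : sinh (x - y) ≠ 0) :
    sinh (ξ + x) * sinh (ξ + y) / sinh (x + y)
      - sinh (ξ + x) * sinh (ξ - y) / sinh (x - y)
      - sinh (ξ - x) * sinh (ξ + y) / sinh (y - x)
      + sinh (ξ - x) * sinh (ξ - y) / sinh (-x - y) = 0 := by
  have key : ∀ a b : ℂ, sinh (ξ + a) * sinh (ξ + b) - sinh (ξ - a) * sinh (ξ - b)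
      = 2 * sinh ξ * cosh ξ * sinh (a + b) := by
    intro a b
    simp only [sinh_add, sinh_sub]
    ring
  have h1 := key x y
  have h2 := key x (-y)
  rw [sub_neg_eq_add, ← sub_eq_add_neg, ← sub_eq_add_neg] at h2
  have e1 : sinh (y - x) = - sinh (x - y) := by rw [← sinh_neg, neg_sub]
  have e2 : sinh (-x - y) = - sinh (x + y) := by rw [← sinh_neg]; congr 1; ring
  rw [e1, e2, div_neg, div_neg]
  have g1 := (div_eq_iff hxy).2 h1
  have g2 := (div_eq_iff hxy').2 h2
  rw [sub_div] at g1 g2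
  linear_combination g1 - g2
end

section
/- Let d ≥ 1 be an integer and ξ, t, ℓ, η complex numbers, and let x₁,…,x_d be complex numbers. For a subset I ⊆ {1,…,d} set ε_i^{(I)} = +1 if i ∈ I and ε_i^{(I)} = −1 otherwise, and x_i^{(I)} = x_i − ε_i^{(I)}·η/2, and define Q_I(x;t) := (−1)^{|I|} · (∏_{i=1}^d sinh(ξ + ε_i^{(I)} x_i)·sinh(t + ε_i^{(I)} x_i + ℓη)) · ∏_{1≤i<j≤d} sinh(x_i^{(I)} + x_j^{(I)})·sinh(x_i^{(I)} − x_j^{(I)}). Then the sum of Q_I(x;t) over all subsets I ⊆ {1,…,d} equals (∏_{1≤i<j≤d} sinh(x_i + x_j)·sinh(x_i − x_j)) · (∏_{i=1}^d sinh(2x_i)) · (−1)^d · ∏_{i=1}^d sinh(ξ + t + (ℓ − i + 1)η). -/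
open Complex Finset

/-- The sign `ε_i^{(I)}`: `+1` if `i ∈ I`, `-1` otherwise. -/
noncomputable def epsSign {d : ℕ} (I : Finset (Fin d)) (i : Fin d) : ℂ :=
  if i ∈ I then 1 else -1

/-- The term `Q_I(x;t)` of the multivariate trigonometric identity (Pequation). -/
noncomputable def Qterm {d : ℕ} (ξ t ℓ η : ℂ) (x : Fin d → ℂ) (I : Finset (Fin d)) : ℂ :=
  (-1 : ℂ) ^ I.card
    * (∏ i, sinh (ξ + epsSign I i * x i) * sinh (t + epsSign I i * x i + ℓ * η))
    * ∏ p ∈ Finset.univ.filter (fun p : Fin d × Fin d => p.1 < p.2),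
        sinh ((x p.1 - epsSign I p.1 * (η / 2)) + (x p.2 - epsSign I p.2 * (η / 2)))
          * sinh ((x p.1 - epsSign I p.1 * (η / 2)) - (x p.2 - epsSign I p.2 * (η / 2)))

lemma sinh_pair (u v : ℂ) : sinh (u + v) * sinh (u - v) = (-1/2) * (cosh (2*v) - cosh (2*u)) := by
  rw [sinh_add, sinh_sub, cosh_two_mul, cosh_two_mul, cosh_sq u, cosh_sq v]
  ring_nf
  rw [cosh_sq u, cosh_sq v]; ring

lemma pair_prod {d : ℕ} (y : Fin d → ℂ) :
    ∏ p ∈ Finset.univ.filter (fun p : Fin d × Fin d => p.1 < p.2),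
        sinh (y p.1 + y p.2) * sinh (y p.1 - y p.2)
    = (∏ p ∈ Finset.univ.filter (fun p : Fin d × Fin d => p.1 < p.2), (-1/2 : ℂ))
      * (Matrix.vandermonde (fun i => cosh (2 * y i))).det := by
  rw [Matrix.det_vandermonde]
  have h : ∏ i : Fin d, ∏ j ∈ Finset.Ioi i, (cosh (2 * y j) - cosh (2 * y i))
      = ∏ p ∈ Finset.univ.filter (fun p : Fin d × Fin d => p.1 < p.2),
        (cosh (2 * y p.2) - cosh (2 * y p.1)) := by
    rw [Finset.prod_filter, Fintype.prod_prod_type]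
    refine Finset.prod_congr rfl fun i _ => ?_
    rw [← Finset.prod_filter]
    refine Finset.prod_congr ?_ fun _ _ => rfl
    ext j; simp
  rw [h, ← Finset.prod_mul_distrib]
  exact Finset.prod_congr rfl fun p _ => sinh_pair _ _

open Polynomial in
lemma polys (ξ T η : ℂ) (k : ℕ) : ∃ G H : ℂ[X],
    G.natDegree ≤ k + 1 ∧ H.natDegree ≤ k ∧
    G.coeff (k+1) = cosh (ξ + T - k * η) / 2 ∧ H.coeff k = sinh (ξ + T - k * η) / 2 ∧
    ∀ x : ℂ, sinh (ξ + x) * sinh (T + x) * cosh (2 * x - η) ^ k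
      = G.eval (cosh (2*x)) + sinh (2*x) * H.eval (cosh (2*x)) := by
  induction k with
  | zero =>
    refine ⟨C (cosh (ξ+T)/2) * X + C (-cosh (ξ - T)/2), C (sinh (ξ+T)/2), ?_, ?_, ?_, ?_, ?_⟩
    · exact natDegree_linear_le
    · simp
    · simp [coeff_C]
    · simp
    · intro x
      have h := sinh_pair ((ξ+T)/2 + x) ((ξ-T)/2)
      rw [show (ξ+T)/2 + x + (ξ-T)/2 = ξ + x by ring, show (ξ+T)/2 + x - (ξ-T)/2 = T + x by ring,
        show 2 * ((ξ-T)/2) = ξ - T by ring, show 2 * ((ξ+T)/2 + x) = (ξ + T) + 2 * x by ring,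
        cosh_add (ξ+T)] at h
      simp only [pow_zero, mul_one, h, eval_add, eval_mul, eval_C, eval_X]
      ring
  | succ k ih =>
    obtain ⟨G, H, hG, hH, cG, cH, h⟩ := ih
    refine ⟨C (cosh η) * (G * X) - C (sinh η) * (H * X * X - H),
      C (cosh η) * (H * X) - C (sinh η) * G, ?_, ?_, ?_, ?_, ?_⟩
    · have h1 : (H * X).natDegree ≤ k + 1 := natDegree_mul_le_of_le hH natDegree_X_le
      have h2 : (H * X * X).natDegree ≤ k + 1 + 1 := natDegree_mul_le_of_le h1 natDegree_X_le
      have h3 : (G * X).natDegree ≤ k + 1 + 1 := natDegree_mul_le_of_le hG natDegree_X_le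
      refine (natDegree_sub_le _ _).trans (max_le ?_ ?_)
      · exact (natDegree_C_mul_le _ _).trans h3
      · exact (natDegree_C_mul_le _ _).trans ((natDegree_sub_le _ _).trans (max_le h2 (by omega)))
    · have h1 : (H * X).natDegree ≤ k + 1 := natDegree_mul_le_of_le hH natDegree_X_le
      refine (natDegree_sub_le _ _).trans (max_le ?_ ?_)
      · exact (natDegree_C_mul_le _ _).trans h1
      · exact (natDegree_C_mul_le _ _).trans hG
    · have h0 : H.coeff (k+1+1) = 0 := coeff_eq_zero_of_natDegree_lt (by omega)
      simp only [coeff_sub, coeff_C_mul, coeff_mul_X, cG, cH, h0]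
      rw [show ξ + T - ((k+1 : ℕ) : ℂ) * η = (ξ + T - k * η) - η by push_cast; ring, cosh_sub _ η]
      ring
    · simp only [coeff_sub, coeff_C_mul, coeff_mul_X, cG, cH]
      rw [show ξ + T - ((k+1 : ℕ) : ℂ) * η = (ξ + T - k * η) - η by push_cast; ring, sinh_sub _ η]
      ring
    · intro x
      rw [pow_succ, ← mul_assoc, h, cosh_sub]
      simp only [eval_sub, eval_mul, eval_C, eval_X]
      have := cosh_sq (2*x)
      linear_combination (- sinh η * H.eval (cosh (2*x))) * (-this)

open Polynomial in
lemma det_polys {d : ℕ} (P : Fin d → ℂ[X]) (hP : ∀ k, (P k).natDegree ≤ k) (u : Fin d → ℂ) :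
    (Matrix.of fun i k => (P k).eval (u i)).det
      = (Matrix.vandermonde u).det * ∏ k, (P k).coeff k := by
  rw [Matrix.eval_matrixOfPolynomials_eq_vandermonde_mul_matrixOfPolynomials u P hP,
    Matrix.det_mul]
  congr 1
  rw [Matrix.det_of_upperTriangular]
  · rfl
  · intro i j hij
    simp only [id] at hij
    exact coeff_eq_zero_of_natDegree_lt (lt_of_le_of_lt (hP j) hij)

/-- The multivariate trigonometric identity (Pequation) of the paper
(Lemma `multivariable`): the sum of `Q_I(x;t)` over all subsets `I ⊆ {1,…,d}`
equals the type-C Weyl denominator times `(-1)^d ∏_{i=1}^d sinh(ξ+t+(ℓ-i+1)η)`.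
Here `i : Fin d` (so `i = 0,…,d-1`) corresponds to the paper's `i+1 = 1,…,d`. -/
theorem multivariate_sinh_identity (d : ℕ) (hd : 1 ≤ d) (ξ t ℓ η : ℂ) (x : Fin d → ℂ) :
    ∑ I : Finset (Fin d), Qterm ξ t ℓ η x I
      = (∏ p ∈ Finset.univ.filter (fun p : Fin d × Fin d => p.1 < p.2),
            sinh (x p.1 + x p.2) * sinh (x p.1 - x p.2))
        * (∏ i, sinh (2 * x i))
        * (-1 : ℂ) ^ d
        * ∏ i : Fin d, sinh (ξ + t + (ℓ - (i : ℕ)) * η) := by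
  choose G H hG hH cG cH hGH using polys ξ (t + ℓ * η) η
  set K : ℂ := ∏ p ∈ Finset.univ.filter (fun p : Fin d × Fin d => p.1 < p.2), (-1/2 : ℂ) with hK
  let F : ℂ → ℂ := fun x => sinh (ξ + x) * sinh (t + ℓ * η + x)
  let m : Fin d → Fin d → ℂ := fun i k => -F (x i) * cosh (2 * x i - η) ^ (k : ℕ)
  let m' : Fin d → Fin d → ℂ := fun i k => F (-x i) * cosh (2 * x i + η) ^ (k : ℕ)
  have hQ : ∀ I : Finset (Fin d), Qterm ξ t ℓ η x I
      = K * Matrix.detRowAlternating (R := ℂ) (I.piecewise m m') := by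
    intro I
    unfold Qterm
    rw [pair_prod (fun i => x i - epsSign I i * (η / 2)), ← hK]
    have e : (I.piecewise m m' : Fin d → Fin d → ℂ) = Matrix.of fun i k =>
        ((if i ∈ I then -1 else 1) *
          (sinh (ξ + epsSign I i * x i) * sinh (t + epsSign I i * x i + ℓ * η))) *
        Matrix.vandermonde (fun i => cosh (2 * (x i - epsSign I i * (η / 2)))) i k := by
      funext i k
      by_cases hi : i ∈ I
      · simp only [Finset.piecewise, hi, if_true, m, F, epsSign, Matrix.of_apply,
          Matrix.vandermonde_apply]
        ring_nf
      · simp only [Finset.piecewise, hi, if_false, m', F, epsSign, Matrix.of_apply,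
          Matrix.vandermonde_apply]
        ring_nf
    rw [e]
    have := Matrix.det_mul_column (fun i => ((if i ∈ I then -1 else 1) *
          (sinh (ξ + epsSign I i * x i) * sinh (t + epsSign I i * x i + ℓ * η))))
        (Matrix.vandermonde (fun i => cosh (2 * (x i - epsSign I i * (η / 2)))))
    change _ = K * Matrix.det _
    rw [this, Finset.prod_mul_distrib (f := fun i => (if i ∈ I then (-1:ℂ) else 1))]
    have s : (∏ i, (if i ∈ I then (-1:ℂ) else 1)) = (-1) ^ I.card := by
      simp [Finset.prod_ite_mem]
    rw [s]; ring
  simp_rw [hQ]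
  rw [← Finset.mul_sum]
  have hadd := (Matrix.detRowAlternating (n := Fin d) (R := ℂ)).toMultilinearMap.map_add_univ m m'
  change Matrix.det (m + m') = ∑ s : Finset (Fin d), Matrix.detRowAlternating (s.piecewise m m') at hadd
  rw [← hadd]
  have e : (m + m' : Fin d → Fin d → ℂ) = Matrix.of fun i k => sinh (2 * x i) *
      (Matrix.of fun (i : Fin d) (k : Fin d) =>
        (Polynomial.C (-2) * H k).eval (cosh (2 * x i))) i k := by
    funext i k
    have h1 := hGH k (x i)
    have h2 := hGH k (-x i)
    rw [show 2 * -x i - η = -(2 * x i + η) by ring, show 2 * -x i = -(2 * x i) by ring,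
      cosh_neg, cosh_neg, sinh_neg] at h2
    simp only [Pi.add_apply, m, m', F, Matrix.of_apply, Polynomial.eval_mul, Polynomial.eval_C]
    linear_combination h2 - h1
  rw [e, Matrix.det_mul_column, det_polys (fun k : Fin d => Polynomial.C (-2) * H k)
    (fun k => (Polynomial.natDegree_C_mul_le _ _).trans (hH k)), pair_prod, ← hK]
  have s : ∏ k : Fin d, (Polynomial.C (-2) * H k).coeff k
      = (-1) ^ d * ∏ i : Fin d, sinh (ξ + t + (ℓ - (i : ℕ)) * η) := by
    have c : (-1 : ℂ) ^ d = ∏ i : Fin d, (-1 : ℂ) := by simp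
    rw [c, ← Finset.prod_mul_distrib]
    refine Finset.prod_congr rfl fun k _ => ?_
    rw [Polynomial.coeff_C_mul, cH]
    rw [show ξ + t + (ℓ - (k : ℕ)) * η = ξ + (t + ℓ * η) - (k : ℕ) * η by ring]
    ring
  rw [s]; ring
end

section
/- Let d ≥ 1 be an integer and ξ, t, ℓ, η complex numbers, and for x = (x₁,…,x_d) ∈ ℂ^d and a subset I ⊆ {1,…,d} let Q_I(x;t) be as follows: with ε_i^{(I)} = +1 if i ∈ I and −1 otherwise, and x_i^{(I)} = x_i − ε_i^{(I)}·η/2, set Q_I(x;t) := (−1)^{|I|} · (∏_{i=1}^d sinh(ξ + ε_i^{(I)} x_i)·sinh(t + ε_i^{(I)} x_i + ℓη)) · ∏_{1≤i<j≤d} sinh(x_i^{(I)} + x_j^{(I)})·sinh(x_i^{(I)} − x_j^{(I)}). Then: (i) for each 1 ≤ i < d, Q_I(s_i x; t) = −Q_{s_i I}(x;t), where s_i x is x with coordinates i and i+1 interchanged and s_i I is the subset obtained from I by interchanging membership of i and i+1; and (ii) Q_I(x'; t) = −Q_{s_d I}(x;t), where x' is x with x_d replaced by −x_d and s_d I is I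 with the membership of d toggled. In particular the sum V(x;t) = Σ_{I⊆{1,…,d}} Q_I(x;t) is anti-invariant under permutations and sign changes of the coordinates x₁,…,x_d. -/
open Complex Finset

/-- The sum `V(x;t) = Σ_{I ⊆ {1,…,d}} Q_I(x;t)`. -/
noncomputable def Vsum {d : ℕ} (ξ t ℓ η : ℂ) (x : Fin d → ℂ) : ℂ :=
  ∑ I : Finset (Fin d), Qterm ξ t ℓ η x I

noncomputable def Gterm {d : ℕ} (ξ t ℓ η : ℂ) (x e : Fin d → ℂ) : ℂ :=
  (∏ i, (-e i))
    * (∏ i, sinh (ξ + e i * x i) * sinh (t + e i * x i + ℓ * η))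
    * (Matrix.vandermonde (fun i => -(sinh (x i - e i * (η / 2))) ^ 2)).det

lemma sinh_add_mul_sinh_sub (a b : ℂ) :
    sinh (a + b) * sinh (a - b) = -(sinh b) ^ 2 - -(sinh a) ^ 2 := by
  rw [Complex.sinh_add, Complex.sinh_sub]
  have h1 := Complex.cosh_sq a
  have h2 := Complex.cosh_sq b
  linear_combination (-(sinh b) ^ 2) * h1 + (sinh a) ^ 2 * h2

lemma neg_one_pow_card_eps {d : ℕ} (I : Finset (Fin d)) :
    (-1 : ℂ) ^ I.card = ∏ i, (-epsSign I i) := by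
  have : ∀ i, -epsSign I i = if i ∈ I then (-1 : ℂ) else 1 := by
    intro i; unfold epsSign; split_ifs <;> simp
  simp [this, Finset.prod_ite]

lemma Qterm_eq_G {d : ℕ} (ξ t ℓ η : ℂ) (x : Fin d → ℂ) (I : Finset (Fin d)) :
    Qterm ξ t ℓ η x I = Gterm ξ t ℓ η x (epsSign I) := by
  unfold Qterm Gterm
  rw [neg_one_pow_card_eps, Matrix.det_vandermonde]
  congr 1
  rw [Finset.prod_filter, Fintype.prod_prod_type]
  refine Finset.prod_congr rfl fun i _ => ?_
  rw [← Finset.prod_filter]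
  refine Finset.prod_congr (by ext; simp) fun j _ => ?_
  exact sinh_add_mul_sinh_sub _ _

lemma G_perm {d : ℕ} (ξ t ℓ η : ℂ) (x e : Fin d → ℂ) (σ : Equiv.Perm (Fin d)) :
    Gterm ξ t ℓ η (x ∘ σ) (e ∘ σ) = ((Equiv.Perm.sign σ : ℤ) : ℂ) * Gterm ξ t ℓ η x e := by
  unfold Gterm
  have h1 : ∏ i, (-(e ∘ σ) i) = ∏ i, (-e i) := Equiv.prod_comp σ (fun i => -e i)
  have h2 := Equiv.prod_comp σ
    (fun i => sinh (ξ + e i * x i) * sinh (t + e i * x i + ℓ * η))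
  have h3 := Matrix.det_permute σ
    (Matrix.vandermonde (fun i => -(sinh (x i - e i * (η / 2))) ^ 2))
  have h4 : (Matrix.vandermonde (fun i => -(sinh ((x ∘ σ) i - (e ∘ σ) i * (η / 2))) ^ 2))
     = (Matrix.vandermonde (fun i => -(sinh (x i - e i * (η / 2))) ^ 2)).submatrix σ id := by
    ext i j; simp [Matrix.vandermonde]
  rw [h1, h4, h3]
  simp only [Function.comp] at *
  rw [h2]
  ring

lemma G_sign {d : ℕ} (ξ t ℓ η : ℂ) (x e ε : Fin d → ℂ) (hε : ∀ i, ε i = 1 ∨ ε i = -1) :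
    Gterm ξ t ℓ η (fun i => ε i * x i) e
      = (∏ i, ε i) * Gterm ξ t ℓ η x (fun i => ε i * e i) := by
  unfold Gterm
  have h1 : ∏ i, (-e i) = (∏ i, ε i) * ∏ i, (-(ε i * e i)) := by
    rw [← Finset.prod_mul_distrib]
    refine Finset.prod_congr rfl fun i _ => ?_
    rcases hε i with h | h <;> simp [h]
  have h2 : ∀ i, e i * (ε i * x i) = ε i * e i * x i := fun i => by ring
  have h3 : ∀ i, (sinh (ε i * x i - e i * (η / 2))) ^ 2
      = (sinh (x i - ε i * e i * (η / 2))) ^ 2 := by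
    intro i
    rcases hε i with h | h
    · simp [h]
    · rw [h, show -1 * x i - e i * (η / 2) = -(x i - -1 * e i * (η / 2)) by ring,
        Complex.sinh_neg, neg_sq]
  simp only [h2, h3]
  rw [h1]
  ring

lemma eps_image {d : ℕ} (I : Finset (Fin d)) (σ : Equiv.Perm (Fin d)) :
    epsSign (I.image σ) ∘ σ = epsSign I := by
  ext i; simp [epsSign]

lemma Q_perm {d : ℕ} (ξ t ℓ η : ℂ) (x : Fin d → ℂ) (σ : Equiv.Perm (Fin d))
    (I : Finset (Fin d)) :
    Qterm ξ t ℓ η (x ∘ σ) I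
      = ((Equiv.Perm.sign σ : ℤ) : ℂ) * Qterm ξ t ℓ η x (I.image σ) := by
  rw [Qterm_eq_G, Qterm_eq_G, ← G_perm, eps_image]

lemma Q_sign {d : ℕ} (ξ t ℓ η : ℂ) (x ε : Fin d → ℂ) (hε : ∀ i, ε i = 1 ∨ ε i = -1)
    (I J : Finset (Fin d)) (hJ : ∀ i, epsSign J i = ε i * epsSign I i) :
    Qterm ξ t ℓ η (fun i => ε i * x i) I = (∏ i, ε i) * Qterm ξ t ℓ η x J := by
  rw [Qterm_eq_G, Qterm_eq_G, G_sign _ _ _ _ _ _ _ hε, funext hJ]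

lemma V_perm {d : ℕ} (ξ t ℓ η : ℂ) (x : Fin d → ℂ) (σ : Equiv.Perm (Fin d)) :
    Vsum ξ t ℓ η (x ∘ σ) = ((Equiv.Perm.sign σ : ℤ) : ℂ) * Vsum ξ t ℓ η x := by
  unfold Vsum
  rw [Finset.mul_sum]
  refine Fintype.sum_bijective (fun I : Finset (Fin d) => I.image σ) ?_ _ _
    (fun I => Q_perm ξ t ℓ η x σ I)
  exact Finite.injective_iff_bijective.1 (Finset.image_injective σ.injective)

lemma V_sign {d : ℕ} (ξ t ℓ η : ℂ) (x ε : Fin d → ℂ) (hε : ∀ i, ε i = 1 ∨ ε i = -1) :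
    Vsum ξ t ℓ η (fun i => ε i * x i) = (∏ i, ε i) * Vsum ξ t ℓ η x := by
  classical
  unfold Vsum
  rw [Finset.mul_sum]
  refine Fintype.sum_bijective
    (fun I : Finset (Fin d) => symmDiff I (Finset.univ.filter fun i => ε i = -1)) ?_ _ _
    (fun I => Q_sign ξ t ℓ η x ε hε I _ ?_)
  · exact (symmDiff_left_involutive _).bijective
  · intro i
    have h0 : (1 : ℂ) ≠ -1 := by norm_num
    rcases hε i with h | h <;> by_cases hi : i ∈ I <;>
      simp [epsSign, Finset.mem_symmDiff, h, hi, h0]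

/-- Transformation property (Qtransformation) of the terms `Q_I` under the generators
of the Weyl group of type `C_d`:
(i) for adjacent transpositions `s_i` (`1 ≤ i < d`), `Q_I(s_i x;t) = -Q_{s_i I}(x;t)`;
(ii) for the sign flip `s_d` of the last coordinate, `Q_I(x';t) = -Q_{s_d I}(x;t)`;
and in particular `V(x;t)` is anti-invariant under all permutations and sign
changes of the coordinates. -/
theorem Qterm_weyl_transformation (d : ℕ) (hd : 1 ≤ d) (ξ t ℓ η : ℂ) (x : Fin d → ℂ) :
    -- (i) adjacent transpositions
    (∀ (i j : Fin d), (j : ℕ) = (i : ℕ) + 1 →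
      ∀ I : Finset (Fin d),
        Qterm ξ t ℓ η (x ∘ Equiv.swap i j) I
          = - Qterm ξ t ℓ η x (I.image (Equiv.swap i j)))
    ∧
    -- (ii) sign flip of the last coordinate
    (∀ I : Finset (Fin d),
      Qterm ξ t ℓ η (Function.update x ⟨d - 1, by omega⟩ (-(x ⟨d - 1, by omega⟩))) I
        = - Qterm ξ t ℓ η x
            (if (⟨d - 1, by omega⟩ : Fin d) ∈ I then I.erase ⟨d - 1, by omega⟩
             else insert (⟨d - 1, by omega⟩ : Fin d) I))
    ∧
    -- anti-invariance of `V` under permutations and sign changes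
    (∀ (σ : Equiv.Perm (Fin d)) (ε : Fin d → ℂ), (∀ i, ε i = 1 ∨ ε i = -1) →
      Vsum ξ t ℓ η (fun i => ε i * x (σ i))
        = ((Equiv.Perm.sign σ : ℤ) : ℂ) * (∏ i, ε i) * Vsum ξ t ℓ η x) := by
  refine ⟨?_, ?_, ?_⟩
  · intro i j hij I
    have hne : i ≠ j := by rintro rfl; omega
    rw [Q_perm, Equiv.Perm.sign_swap hne]
    simp
  · intro I
    generalize (⟨d - 1, by omega⟩ : Fin d) = k
    have h := Q_sign ξ t ℓ η x (fun i => if i = k then -1 else 1)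
      (by intro i; split_ifs <;> simp) I
      (if k ∈ I then I.erase k else insert k I) (by
        intro i
        by_cases hk : k ∈ I <;> by_cases hi : i = k
        · subst hi; simp [epsSign, hk]
        · simp [epsSign, hk, hi]
        · subst hi; simp [epsSign, hk]
        · simp [epsSign, hk, hi])
    have hx : Function.update x k (-(x k)) = fun i => (if i = k then (-1 : ℂ) else 1) * x i := by
      ext i
      by_cases hi : i = k
      · subst hi; simp
      · simp [hi]
    rw [hx, h]
    simp
  · intro σ ε hε
    have h := V_sign ξ t ℓ η (x ∘ σ) ε hε
    rw [V_perm] at h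
    simp only [Function.comp] at h
    rw [h]; ring
end

section
/- Let d ≥ 1 be an integer and ξ, ℓ, η complex numbers. For x = (x₁,…,x_d) ∈ ℂ^d and I ⊆ {1,…,d} define Q_I(x;t) as follows: with ε_i^{(I)} = +1 if i ∈ I and −1 otherwise, and x_i^{(I)} = x_i − ε_i^{(I)}·η/2, set Q_I(x;t) := (−1)^{|I|} · (∏_{i=1}^d sinh(ξ + ε_i^{(I)} x_i)·sinh(t + ε_i^{(I)} x_i + ℓη)) · ∏_{1≤i<j≤d} sinh(x_i^{(I)} + x_j^{(I)})·sinh(x_i^{(I)} − x_j^{(I)}). Define V(x;t) := (∏_{i=1}^d sinh(ξ − t + (ℓ − i + 1)η)) · Σ_{I⊆{1,…,d}} Q_I(x;t). Then V(x;t) = V(x;−t) for all t ∈ ℂ. -/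
open Complex Finset

/-- The rescaled sum `V(x;t) := (∏_{i=1}^d sinh(ξ−t+(ℓ−i+1)η)) · Σ_{I} Q_I(x;t)`.
Here `i : Fin d` corresponds to the paper's index `i+1 ∈ {1,…,d}`, so
`ℓ − (i+1) + 1 = ℓ − i`. -/
noncomputable def Vresc {d : ℕ} (ξ ℓ η : ℂ) (x : Fin d → ℂ) (t : ℂ) : ℂ :=
  (∏ i : Fin d, sinh (ξ - t + (ℓ - (i : ℕ)) * η))
    * ∑ I : Finset (Fin d), Qterm ξ t ℓ η x I

lemma aux_sinh_mul (a b : ℂ) : sinh (a + b) * sinh (a - b) = (cosh (2 * a) - cosh (2 * b)) / 2 := by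
  have h1 := Complex.cosh_sq a
  have h2 := Complex.cosh_sq b
  rw [sinh_add, sinh_sub, cosh_two_mul, cosh_two_mul]
  linear_combination -(sinh b ^ 2 + 1/2) * h1 + (1/2 + sinh a ^ 2) * h2

lemma aux_poly (ξ u η : ℂ) (k : ℕ) : ∃ a b : Polynomial ℂ,
    (∀ n, k + 1 < n → a.coeff n = 0) ∧ (∀ n, k < n → b.coeff n = 0) ∧
    a.coeff (k + 1) = (-1/2) ^ k / 2 * cosh (ξ + u - k * η) ∧
    b.coeff k = (-1/2) ^ k / 2 * sinh (ξ + u - k * η) ∧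
    ∀ x e : ℂ, (e = 1 ∨ e = -1) →
      sinh (ξ + e * x) * sinh (u + e * x) * (-cosh (2 * x - e * η) / 2) ^ k
        = a.eval (cosh (2 * x)) + e * sinh (2 * x) * b.eval (cosh (2 * x)) := by
  induction k with
  | zero =>
    refine ⟨Polynomial.C (cosh (ξ + u) / 2) * Polynomial.X - Polynomial.C (cosh (ξ - u) / 2),
      Polynomial.C (sinh (ξ + u) / 2), ?_, ?_, ?_, ?_, ?_⟩
    · intro n hn
      obtain ⟨m, rfl⟩ : ∃ m, n = m + 2 := ⟨n - 2, by omega⟩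
      simp [Polynomial.coeff_C, Polynomial.coeff_X]
    · intro n hn
      simp [Polynomial.coeff_C, hn.ne']
    · simp [Polynomial.coeff_C]; ring
    · simp; ring
    · intro x e he
      have h := aux_sinh_mul ((ξ + u) / 2 + e * x) ((ξ - u) / 2)
      have e1 : (ξ + u) / 2 + e * x + (ξ - u) / 2 = ξ + e * x := by ring
      have e2 : (ξ + u) / 2 + e * x - (ξ - u) / 2 = u + e * x := by ring
      have e3 : 2 * ((ξ + u) / 2 + e * x) = (ξ + u) + e * (2 * x) := by ring
      have e4 : 2 * ((ξ - u) / 2) = ξ - u := by ring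
      rw [e1, e2, e3, e4] at h
      rw [h, cosh_add]
      rcases he with rfl | rfl <;> simp <;> ring
  | succ k ih =>
    obtain ⟨a, b, ha, hb, hak, hbk, h⟩ := ih
    refine ⟨Polynomial.C (-cosh η / 2) * (Polynomial.X * a)
        + Polynomial.C (sinh η / 2) * (Polynomial.X * (Polynomial.X * b) - b),
      Polynomial.C (-cosh η / 2) * (Polynomial.X * b) + Polynomial.C (sinh η / 2) * a,
      ?_, ?_, ?_, ?_, ?_⟩
    · intro n hn
      obtain ⟨m, rfl⟩ : ∃ m, n = m + 2 := ⟨n - 2, by omega⟩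
      simp only [Polynomial.coeff_add, Polynomial.coeff_C_mul, Polynomial.coeff_sub,
        Polynomial.coeff_X_mul]
      rw [ha _ (by omega), hb _ (by omega), hb _ (by omega)]; ring
    · intro n hn
      obtain ⟨m, rfl⟩ : ∃ m, n = m + 1 := ⟨n - 1, by omega⟩
      simp only [Polynomial.coeff_add, Polynomial.coeff_C_mul, Polynomial.coeff_X_mul]
      rw [ha _ (by omega), hb _ (by omega)]; ring
    · simp only [Polynomial.coeff_add, Polynomial.coeff_C_mul, Polynomial.coeff_sub,
        Polynomial.coeff_X_mul]
      rw [hak, hbk, hb _ (by omega)]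
      have : ξ + u - ((k + 1 : ℕ) : ℂ) * η = (ξ + u - k * η) - η := by push_cast; ring
      rw [this, cosh_sub (ξ + u - k * η) η]; ring
    · simp only [Polynomial.coeff_add, Polynomial.coeff_C_mul, Polynomial.coeff_X_mul]
      rw [hak, hbk]
      have : ξ + u - ((k + 1 : ℕ) : ℂ) * η = (ξ + u - k * η) - η := by push_cast; ring
      rw [this, sinh_sub (ξ + u - k * η) η]; ring
    · intro x e he
      have hs := Complex.cosh_sq (2 * x)
      rw [pow_succ, ← mul_assoc, h x e he]
      have hc : cosh (2 * x - e * η) = cosh (2 * x) * cosh η - e * sinh (2 * x) * sinh η := by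
        rcases he with rfl | rfl <;> simp [cosh_add, cosh_sub]
      have he2 : e ^ 2 = 1 := by rcases he with rfl | rfl <;> norm_num
      rw [hc]
      simp only [Polynomial.eval_add, Polynomial.eval_mul, Polynomial.eval_C, Polynomial.eval_sub,
        Polynomial.eval_X]
      linear_combination (sinh (2 * x) ^ 2 * sinh η * b.eval (cosh (2 * x)) / 2) * he2
        - (sinh η * b.eval (cosh (2 * x)) / 2) * hs

lemma aux_det {d : ℕ} (y s β : Fin d → ℂ) (b : Fin d → Polynomial ℂ)
    (hb : ∀ k : Fin d, ∀ n, (k : ℕ) < n → (b k).coeff n = 0)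
    (hβ : ∀ k : Fin d, (b k).coeff k = β k) :
    (Matrix.of fun i k => s i * (b k).eval (y i) : Matrix (Fin d) (Fin d) ℂ).det
      = (∏ i, s i) * ((Matrix.vandermonde y).det * ∏ k, β k) := by
  have h1 : (Matrix.of fun i k => s i * (b k).eval (y i) : Matrix (Fin d) (Fin d) ℂ)
      = Matrix.of fun i k => s i * (Matrix.vandermonde y *
        (Matrix.of fun j k => (b k).coeff j : Matrix (Fin d) (Fin d) ℂ)) i k := by
    ext i k
    simp only [Matrix.of_apply, Matrix.mul_apply, Matrix.vandermonde_apply]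
    congr 1
    have hd : (b k).natDegree < d := by
      refine lt_of_le_of_lt ?_ k.2
      rw [Polynomial.natDegree_le_iff_coeff_eq_zero]
      exact fun n hn => hb k n hn
    rw [Polynomial.eval_eq_sum_range' hd, ← Fin.sum_univ_eq_sum_range
      (fun j => (b k).coeff j * y i ^ j)]
    exact Finset.sum_congr rfl fun _ _ => mul_comm _ _
  rw [h1, Matrix.det_mul_column, Matrix.det_mul]
  congr 2
  rw [Matrix.det_of_upperTriangular]
  · simp [hβ]
  · intro i j hij
    exact hb _ _ hij

lemma aux_Q {d : ℕ} (ξ t ℓ η : ℂ) (x : Fin d → ℂ) (I : Finset (Fin d)) :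
    Qterm ξ t ℓ η x I = (Matrix.of fun i k : Fin d =>
      (-epsSign I i * (sinh (ξ + epsSign I i * x i) * sinh (t + ℓ * η + epsSign I i * x i))) *
      Matrix.vandermonde (fun i => -cosh (2 * x i - epsSign I i * η) / 2) i k).det := by
  have hsign : (-1 : ℂ) ^ I.card = ∏ i, -epsSign I i := by
    simp only [epsSign]
    rw [← Finset.prod_const, ← Finset.prod_subset (Finset.subset_univ I)]
    · exact Finset.prod_congr rfl fun i hi => by simp [hi]
    · intro i _ hi; simp [hi]
  rw [Matrix.det_mul_column, Matrix.det_vandermonde, Qterm, hsign, ← Finset.prod_mul_distrib]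
  congr 1
  · exact Finset.prod_congr rfl fun i _ => by
      rw [show t + epsSign I i * x i + ℓ * η = t + ℓ * η + epsSign I i * x i by ring]
  · rw [Finset.prod_filter, ← Finset.univ_product_univ, Finset.prod_product]
    refine Finset.prod_congr rfl fun i _ => ?_
    rw [← Finset.prod_filter]
    refine Finset.prod_congr (by ext; simp) fun j _ => ?_
    rw [aux_sinh_mul]
    simp only
    rw [show 2 * (x i - epsSign I i * (η / 2)) = 2 * x i - epsSign I i * η by ring,
      show 2 * (x j - epsSign I j * (η / 2)) = 2 * x j - epsSign I j * η by ring]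
    ring

lemma aux_sum {d : ℕ} (ξ t ℓ η : ℂ) (x : Fin d → ℂ) :
    ∑ I : Finset (Fin d), Qterm ξ t ℓ η x I
      = (∏ i, (-2 * sinh (2 * x i))) * ((Matrix.vandermonde fun i => cosh (2 * x i)).det *
        ∏ k : Fin d, ((-1/2) ^ (k : ℕ) / 2 * sinh (ξ + (t + ℓ * η) - (k : ℕ) * η))) := by
  choose a b ha hb hak hbk h using fun k : ℕ => aux_poly ξ (t + ℓ * η) η k
  rw [← aux_det _ _ _ (fun k : Fin d => b k) (fun k n hn => hb k n hn) (fun k => hbk k)]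
  let R : ℂ → Fin d → Fin d → ℂ := fun e i k =>
    (-e * (sinh (ξ + e * x i) * sinh (t + ℓ * η + e * x i))) *
      (-cosh (2 * x i - e * η) / 2) ^ (k : ℕ)
  have h1 : (Matrix.of fun i k : Fin d => -2 * sinh (2 * x i) * (b k).eval (cosh (2 * x i)))
      = Matrix.of (R 1 + R (-1)) := by
    ext i k
    simp only [Matrix.of_apply, Pi.add_apply, R]
    linear_combination h k (x i) 1 (Or.inl rfl) - h k (x i) (-1) (Or.inr rfl)
  rw [h1]
  have h2 := (Matrix.detRowAlternating (n := Fin d) (R := ℂ)).toMultilinearMap.map_add_univ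
    (R 1) (R (-1))
  refine Eq.trans ?_ h2.symm
  refine Finset.sum_congr rfl fun I _ => ?_
  rw [aux_Q]
  change _ = Matrix.det (Matrix.of (I.piecewise (R 1) (R (-1))))
  congr 1
  ext i k
  by_cases hi : i ∈ I <;> simp [hi, R, epsSign, Matrix.vandermonde_apply]

/-- Equation (Pidentity) of the paper: the rescaled sum `V(x;t)` is invariant
under `t ↦ −t`. -/
theorem Vresc_symm (d : ℕ) (hd : 1 ≤ d) (ξ ℓ η : ℂ) (x : Fin d → ℂ) (t : ℂ) :
    Vresc ξ ℓ η x t = Vresc ξ ℓ η x (-t) := by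
  have e1 : ∀ t : ℂ, ∀ k : ℕ, ξ + (t + ℓ * η) - k * η = ξ + t + (ℓ - k) * η := by
    intros; ring
  have e2 : ξ - -t = ξ + t := by ring
  have e3 : ξ + -t = ξ - t := by ring
  simp only [Vresc, aux_sum, e1, Finset.prod_mul_distrib, e2, e3]
  ring
end

section
/- Let d ≥ 1 be an integer, τ, η, ξ, ℓ, t complex numbers and x₁,…,x_d complex numbers. For a subset I ⊆ {1,…,d} with complement I^c define q_I(x;t) := (∏_{i,j∈I, i<j} sinh(x_i+x_j−τ−η)/sinh(x_i+x_j−τ+η)) · (∏_{j∈I^c} ∏_{j'∈I} sinh(x_{j'}−x_j−η)·sinh(x_{j'}+x_j−τ) / (sinh(x_{j'}−x_j)·sinh(x_{j'}+x_j−τ+η))) · ∏_{j∈I} sinh(ξ+x_j−τ/2−η/2)·sinh(t+x_j+ℓη) / (sinh(ξ−x_j+τ/2−η/2)·sinh(t−x_j+τ+ℓη)). Assume that for all i ≠ j in {1,…,d}: sinh(x_i−x_j) ≠ 0 and sinh(x_i+x_j−τ+η) ≠ 0, and that for all j: sinh(ξ−x_j+τ/2−η/2) ≠ 0, sinh(t+x_j−ℓη)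 ≠ 0, sinh(t−x_j+τ+ℓη) ≠ 0, and sinh(t+τ−x_j+ℓη) ≠ 0. Then the expression F(t) := (∏_{n=1}^d sinh(ξ − t − τ/2 + (ℓ + 1/2 − n)η)) · Σ_{I⊆{1,…,d}} (−1)^{|I|} q_I(x;t) / ∏_{j=1}^d sinh(t+x_j−ℓη) is invariant under the substitution t ↦ −t−τ, i.e. F(−t−τ) = F(t). -/
open Complex Finset

/-- The factor `q_I(x;t)` of Lemma (trigident). Here `Iᶜ` is the complement of `I`
in `{1,…,d}` (modelled by `Fin d`). -/
noncomputable def qfact {d : ℕ} (τ η ξ ℓ : ℂ) (x : Fin d → ℂ) (t : ℂ)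
    (I : Finset (Fin d)) : ℂ :=
  (∏ p ∈ Finset.univ.filter
      (fun p : Fin d × Fin d => p.1 ∈ I ∧ p.2 ∈ I ∧ p.1 < p.2),
      sinh (x p.1 + x p.2 - τ - η) / sinh (x p.1 + x p.2 - τ + η))
  * (∏ j ∈ Iᶜ, ∏ j' ∈ I,
      sinh (x j' - x j - η) * sinh (x j' + x j - τ)
        / (sinh (x j' - x j) * sinh (x j' + x j - τ + η)))
  * ∏ j ∈ I,
      sinh (ξ + x j - τ / 2 - η / 2) * sinh (t + x j + ℓ * η)
        / (sinh (ξ - x j + τ / 2 - η / 2) * sinh (t - x j + τ + ℓ * η))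

/-- The expression `F(t)` of Lemma (trigident):
`F(t) = (∏_{n=1}^d sinh(ξ−t−τ/2+(ℓ+1/2−n)η)) · Σ_I (−1)^{|I|} q_I(x;t) / ∏_j sinh(t+x_j−ℓη)`. -/
noncomputable def Ftrig {d : ℕ} (τ η ξ ℓ : ℂ) (x : Fin d → ℂ) (t : ℂ) : ℂ :=
  (∏ n ∈ Finset.range d, sinh (ξ - t - τ / 2 + (ℓ + 1 / 2 - ((n : ℕ) + 1)) * η))
    * ((∑ I : Finset (Fin d), (-1 : ℂ) ^ I.card * qfact τ η ξ ℓ x t I)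
        / ∏ j : Fin d, sinh (t + x j - ℓ * η))

namespace TrigId

noncomputable def P2 {d : ℕ} (f : Fin d → Fin d → ℂ) (s : Finset (Fin d)) : ℂ :=
  ∏ p ∈ Finset.univ.filter
      (fun p : Fin d × Fin d => p.1 ∈ s ∧ p.2 ∈ s ∧ p.1 < p.2), f p.1 p.2

lemma P2_eq {d : ℕ} (f : Fin d → Fin d → ℂ) (s : Finset (Fin d)) :
    P2 f s = ∏ i ∈ s, ∏ j ∈ s, if i < j then f i j else 1 := by
  unfold P2
  rw [← Finset.prod_product' s s (fun i j => if i < j then f i j else 1), ← Finset.prod_filter]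
  apply Finset.prod_congr _ (fun _ _ => rfl)
  ext p
  simp [Finset.mem_product, and_assoc]

lemma P2_congr {d : ℕ} {f g : Fin d → Fin d → ℂ} {s : Finset (Fin d)}
    (h : ∀ i ∈ s, ∀ j ∈ s, i ≠ j → f i j = g i j) : P2 f s = P2 g s := by
  unfold P2
  refine Finset.prod_congr rfl fun p hp => ?_
  simp only [Finset.mem_filter, Finset.mem_univ, true_and] at hp
  exact h _ hp.1 _ hp.2.1 hp.2.2.ne

lemma P2_mul {d : ℕ} (f g : Fin d → Fin d → ℂ) (s : Finset (Fin d)) :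
    P2 f s * P2 g s = P2 (fun i j => f i j * g i j) s := by
  unfold P2
  rw [← Finset.prod_mul_distrib]

lemma P2_ne {d : ℕ} {f : Fin d → Fin d → ℂ} {s : Finset (Fin d)}
    (h : ∀ i j, i ≠ j → f i j ≠ 0) : P2 f s ≠ 0 := by
  unfold P2
  refine Finset.prod_ne_zero_iff.2 fun p hp => ?_
  simp only [Finset.mem_filter, Finset.mem_univ, true_and] at hp
  exact h _ _ hp.2.2.ne

lemma P2_insert {d : ℕ} (f : Fin d → Fin d → ℂ) (hf : ∀ i j, f i j = f j i)
    (s : Finset (Fin d)) (k : Fin d) (hk : k ∉ s) :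
    P2 f (insert k s) = P2 f s * ∏ j ∈ s, f k j := by
  rw [P2_eq, P2_eq, Finset.prod_insert hk]
  simp only [Finset.prod_insert hk, lt_irrefl, if_false, one_mul]
  rw [Finset.prod_mul_distrib, ← mul_assoc, ← Finset.prod_mul_distrib, mul_comm]
  congr 1
  refine Finset.prod_congr rfl fun j hj => ?_
  have hne : k ≠ j := fun h => hk (h ▸ hj)
  rcases lt_or_gt_of_ne hne with h | h
  · simp [h, h.le.not_gt]
  · simp [h, h.le.not_gt, hf j k]

lemma P2_union {d : ℕ} (f : Fin d → Fin d → ℂ) (hf : ∀ i j, f i j = f j i)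
    (s t : Finset (Fin d)) (hst : Disjoint s t) :
    P2 f (s ∪ t) = P2 f s * P2 f t * ∏ j ∈ t, ∏ i ∈ s, f i j := by
  induction t using Finset.induction_on with
  | empty => simp [P2]
  | insert k t hk ih =>
    rw [Finset.disjoint_insert_right] at hst
    rw [Finset.union_insert, P2_insert f hf _ _ (by simp [hst.1, hk]), ih hst.2,
      P2_insert f hf _ _ hk, Finset.prod_insert hk, Finset.prod_union hst.2]
    have : ∏ i ∈ s, f k i = ∏ i ∈ s, f i k := Finset.prod_congr rfl fun i _ => hf _ _
    rw [this]; ring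

/-- trigonometric polynomials -/
def IsTrig (d : ℕ) (f : ℂ → ℂ) : Prop :=
  ∃ p : Polynomial ℂ, p.natDegree ≤ d ∧ ∀ u, exp u ^ d * f u = p.eval (exp (2 * u))

lemma IsTrig.const (c : ℂ) : IsTrig 0 (fun _ => c) :=
  ⟨Polynomial.C c, by simp, by simp⟩

lemma IsTrig.smul {d : ℕ} {f : ℂ → ℂ} (hf : IsTrig d f) (c : ℂ) :
    IsTrig d (fun u => c * f u) := by
  obtain ⟨p, hp, h⟩ := hf
  refine ⟨Polynomial.C c * p, (Polynomial.natDegree_C_mul_le _ _).trans hp, fun u => ?_⟩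
  rw [Polynomial.eval_mul, Polynomial.eval_C, ← h]; ring

lemma IsTrig.add {d : ℕ} {f g : ℂ → ℂ} (hf : IsTrig d f) (hg : IsTrig d g) :
    IsTrig d (fun u => f u + g u) := by
  obtain ⟨p, hp, h⟩ := hf
  obtain ⟨q, hq, h'⟩ := hg
  refine ⟨p + q, Polynomial.natDegree_add_le_of_degree_le hp hq, fun u => ?_⟩
  rw [Polynomial.eval_add, ← h, ← h']; ring

lemma IsTrig.sum {α : Type*} {d : ℕ} (s : Finset α) {f : α → ℂ → ℂ}
    (hf : ∀ a ∈ s, IsTrig d (f a)) : IsTrig d (fun u => ∑ a ∈ s, f a u) := by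
  classical
  induction s using Finset.induction_on with
  | empty => exact ⟨0, by simp, by simp⟩
  | insert k t hk ih =>
    simp only [Finset.sum_insert hk]
    exact (hf k (by simp)).add (ih fun a ha => hf a (by simp [ha]))

lemma IsTrig.sinh_mul {d : ℕ} {f : ℂ → ℂ} (hf : IsTrig d f) (b : ℂ) :
    IsTrig (d + 1) (fun u => sinh (u + b) * f u) := by
  obtain ⟨p, hp, h⟩ := hf
  refine ⟨(Polynomial.C (exp b / 2) * Polynomial.X + Polynomial.C (-exp (-b) / 2)) * p, ?_,
    fun u => ?_⟩
  · refine Polynomial.natDegree_mul_le.trans ?_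
    have := Polynomial.natDegree_linear_le (a := exp b / 2) (b := -exp (-b) / 2)
    omega
  · rw [Polynomial.eval_mul, ← h]
    have e1 : exp (u + b) = exp u * exp b := exp_add _ _
    have e2 : exp u * exp (-(u + b)) = exp (-b) := by rw [← exp_add]; congr 1; ring
    have e3 : exp (2 * u) = exp u * exp u := by rw [← exp_add]; congr 1; ring
    simp only [Polynomial.eval_add, Polynomial.eval_mul, Polynomial.eval_C, Polynomial.eval_X]
    rw [Complex.sinh, e1, e3, pow_succ]
    linear_combination (-exp u ^ d * f u / 2) * e2

lemma IsTrig.prod_sinh {α : Type*} (s : Finset α) (b : α → ℂ) :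
    IsTrig s.card (fun u => ∏ a ∈ s, sinh (u + b a)) := by
  classical
  induction s using Finset.induction_on with
  | empty => simpa using IsTrig.const 1
  | insert k t hk ih =>
    simp only [Finset.prod_insert hk, Finset.card_insert_of_notMem hk]
    exact ih.sinh_mul _

lemma exp_two_ne {u v : ℂ} (h : sinh (u - v) ≠ 0) : exp (2 * u) ≠ exp (2 * v) := by
  intro e
  apply h
  have e1 : exp (u - v) = exp (2 * u) * exp (-u - v) := by rw [← exp_add]; congr 1; ring
  have e2 : exp (-(u - v)) = exp (2 * v) * exp (-u - v) := by rw [← exp_add]; congr 1; ring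
  rw [Complex.sinh, e1, e2, e]; ring

lemma IsTrig.eq_zero {d : ℕ} {f : ℂ → ℂ} (hf : IsTrig d f) (T : Finset ℂ) (hT : d < T.card)
    (hs : ∀ u ∈ T, ∀ v ∈ T, u ≠ v → sinh (u - v) ≠ 0) (h0 : ∀ u ∈ T, f u = 0) (u : ℂ) :
    f u = 0 := by
  obtain ⟨p, hp, h⟩ := hf
  have hp0 : p = 0 := by
    refine Polynomial.eq_zero_of_natDegree_lt_card_of_eval_eq_zero' p
      (T.image fun u => exp (2 * u)) ?_ ?_
    · intro w hw
      obtain ⟨v, hv, rfl⟩ := Finset.mem_image.1 hw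
      rw [← h, h0 v hv, mul_zero]
    · rw [Finset.card_image_of_injOn]
      · omega
      · intro a ha b hb hab
        by_contra hne
        exact exp_two_ne (hs a ha b hb hne) hab
  have := h u
  rw [hp0, Polynomial.eval_zero] at this
  exact (mul_eq_zero.1 this).resolve_left (pow_ne_zero _ (exp_ne_zero _))

def flip {d : ℕ} (I : Finset (Fin d)) (y : Fin d → ℂ) (j : Fin d) : ℂ :=
  if j ∈ I then - y j else y j

noncomputable def G {d : ℕ} (η : ℂ) (z : Fin d → ℂ) (i j : Fin d) : ℂ :=
  sinh (z i + z j + η) / sinh (z i + z j)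

lemma G_symm {d : ℕ} (η : ℂ) (z : Fin d → ℂ) (i j : Fin d) : G η z i j = G η z j i := by
  unfold G; rw [add_comm (z i)]

noncomputable def S {d : ℕ} (η a : ℂ) (y : Fin d → ℂ) (s : Finset (Fin d)) (u : ℂ) : ℂ :=
  ∑ I ∈ s.powerset, (-1 : ℂ) ^ I.card * (P2 (G η (flip I y)) s *
    ∏ j ∈ s, (sinh (a - flip I y j) * sinh (u - flip I y j)))

lemma S_trig {d : ℕ} (η a : ℂ) (y : Fin d → ℂ) (s : Finset (Fin d)) :
    IsTrig s.card (S η a y s) := by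
  unfold S
  refine IsTrig.sum _ fun I _ => ?_
  simp only [Finset.prod_mul_distrib, ← mul_assoc, sub_eq_add_neg _ (flip I y _)]
  exact (IsTrig.prod_sinh _ _).smul _

lemma step_term {d : ℕ} (η a : ℂ) (z : Fin d → ℂ) (s : Finset (Fin d)) (k : Fin d)
    (hk : k ∉ s) (h : ∀ j ∈ s, sinh (z k + z j) ≠ 0) :
    P2 (G η z) (insert k s) * ∏ j ∈ insert k s, (sinh (a - z j) * sinh (- z k - z j))
     = -sinh (2 * z k) * sinh (a - z k) * (P2 (G η z) s *
        ∏ j ∈ s, (sinh (a - z j) * sinh (- z k - η - z j))) := by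
  rw [P2_insert _ (G_symm η z) _ _ hk, Finset.prod_insert hk]
  have : (∏ j ∈ s, G η z k j) * ∏ j ∈ s, (sinh (a - z j) * sinh (- z k - z j))
      = ∏ j ∈ s, (sinh (a - z j) * sinh (- z k - η - z j)) := by
    rw [← Finset.prod_mul_distrib]
    refine Finset.prod_congr rfl fun j hj => ?_
    have h1 : sinh (- z k - z j) = - sinh (z k + z j) := by rw [← sinh_neg]; congr 1; ring
    have h2 : sinh (- z k - η - z j) = - sinh (z k + z j + η) := by
      rw [← sinh_neg]; congr 1; ring
    have := h j hj
    rw [h1, h2, G]; field_simp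
  have h3 : sinh (- z k - z k) = - sinh (2 * z k) := by rw [← sinh_neg]; congr 1; ring
  rw [← this, h3]; ring

lemma flip_congr {d : ℕ} {I : Finset (Fin d)} {y : Fin d → ℂ} {k j : Fin d} (h : j ≠ k) :
    flip (insert k I) y j = flip I y j := by
  simp [flip, h]

def Gen {d : ℕ} (y : Fin d → ℂ) (s : Finset (Fin d)) : Prop :=
  (∀ i ∈ s, ∀ j ∈ s, i ≠ j → sinh (y i - y j) ≠ 0) ∧ (∀ i ∈ s, ∀ j ∈ s, sinh (y i + y j) ≠ 0)

lemma Gen.flip {d : ℕ} {y : Fin d → ℂ} {s : Finset (Fin d)} (h : Gen y s) (I : Finset (Fin d))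
    {i j : Fin d} (hi : i ∈ s) (hj : j ∈ s) (hij : i ≠ j) :
    sinh (TrigId.flip I y i + TrigId.flip I y j) ≠ 0 := by
  have h1 := h.1 i hi j hj hij
  have h2 := h.2 i hi j hj
  have h3 := h.1 j hj i hi hij.symm
  unfold TrigId.flip
  split_ifs
  · rw [← neg_add, sinh_neg]; exact neg_ne_zero.2 h2
  · rwa [neg_add_eq_sub]
  · rwa [← sub_eq_add_neg]
  · exact h2

lemma S_at {d : ℕ} (η a : ℂ) (y : Fin d → ℂ) (s : Finset (Fin d)) (k : Fin d) (hk : k ∉ s)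
    (hG : Gen y (insert k s)) :
    S η a y (insert k s) (y k) = -sinh (2 * y k) * sinh (a + y k) * S η a y s (y k - η) ∧
    S η a y (insert k s) (-y k) = -sinh (2 * y k) * sinh (a - y k) * S η a y s (-y k - η) := by
  have hne : ∀ j ∈ s, j ≠ k := fun j hj h => hk (h ▸ hj)
  constructor
  · unfold S
    rw [Finset.sum_powerset_insert hk, Finset.sum_eq_zero, zero_add, Finset.mul_sum]
    · refine Finset.sum_congr rfl fun I hI => ?_
      have hkI : k ∉ I := fun h => hk (Finset.mem_powerset.1 hI h)
      have hz : flip (insert k I) y k = - y k := by simp [flip]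
      have := step_term η a (flip (insert k I) y) s k hk
        (fun j hj => hG.flip _ (by simp) (by simp [hj]) (hne j hj).symm)
      rw [hz] at this
      simp only [neg_neg] at this
      rw [this, Finset.card_insert_of_notMem hkI]
      have e1 : P2 (G η (flip (insert k I) y)) s = P2 (G η (flip I y)) s :=
        P2_congr fun i hi j hj _ => by
          unfold G; rw [flip_congr (hne i hi), flip_congr (hne j hj)]
      have e2 : ∏ j ∈ s, (sinh (a - flip (insert k I) y j) *
            sinh (y k - η - flip (insert k I) y j))
          = ∏ j ∈ s, (sinh (a - flip I y j) * sinh (y k - η - flip I y j)) :=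
        Finset.prod_congr rfl fun j hj => by rw [flip_congr (hne j hj)]
      rw [e1, e2, mul_neg 2, sinh_neg, sub_neg_eq_add]; ring
    · intro I hI
      have hkI : k ∉ I := fun h => hk (Finset.mem_powerset.1 hI h)
      rw [Finset.prod_insert hk]
      simp [flip, hkI]
  · unfold S
    rw [Finset.sum_powerset_insert hk, add_comm, Finset.sum_eq_zero, zero_add, Finset.mul_sum]
    · refine Finset.sum_congr rfl fun I hI => ?_
      have hkI : k ∉ I := fun h => hk (Finset.mem_powerset.1 hI h)
      have hz : flip I y k = y k := by simp [flip, hkI]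
      have := step_term η a (flip I y) s k hk
        (fun j hj => hG.flip _ (by simp) (by simp [hj]) (hne j hj).symm)
      rw [hz] at this
      rw [this]; ring
    · intro I hI
      rw [Finset.prod_insert hk]
      simp [flip]

lemma S_formula {d : ℕ} (η : ℂ) (y : Fin d → ℂ) (n : ℕ) : ∀ (s : Finset (Fin d)), s.card = n →
    Gen y s → ∀ a u : ℂ, S η a y s u =
      (∏ j ∈ s, -sinh (2 * y j)) * ∏ m ∈ Finset.range n, sinh (u + (a - m * η)) := by
  induction n with
  | zero =>
    intro s hs _ a u
    rw [Finset.card_eq_zero] at hs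
    subst hs
    simp [S, P2]
  | succ n ih =>
    intro s hs hG a u
    rw [← sub_eq_zero]
    have key : ∀ k ∈ s, ∃ s', k ∉ s' ∧ insert k s' = s ∧ s'.card = n ∧ Gen y s' := by
      intro k hk
      refine ⟨s.erase k, by simp, Finset.insert_erase hk, ?_, ?_, ?_⟩
      · rw [Finset.card_erase_of_mem hk]; omega
      · intro i hi j hj
        exact hG.1 i (Finset.mem_of_mem_erase hi) j (Finset.mem_of_mem_erase hj)
      · intro i hi j hj
        exact hG.2 i (Finset.mem_of_mem_erase hi) j (Finset.mem_of_mem_erase hj)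
    obtain ⟨k0, hk0⟩ : s.Nonempty := Finset.card_pos.1 (by omega)
    have hinj : Set.InjOn y s := by
      intro i hi j hj hij
      by_contra hne
      exact hG.1 i hi j hj hne (by rw [hij, sub_self, sinh_zero])
    have hnot : -y k0 ∉ s.image y := by
      intro h
      obtain ⟨j, hj, e⟩ := Finset.mem_image.1 h
      exact hG.2 j hj k0 hk0 (by rw [e]; simp)
    have hT : IsTrig (n + 1) (fun u => S η a y s u -
        (∏ j ∈ s, -sinh (2 * y j)) * ∏ m ∈ Finset.range (n + 1), sinh (u + (a - m * η))) := by
      have h1 := S_trig η a y s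
      rw [hs] at h1
      have h2 := (IsTrig.prod_sinh (Finset.range (n + 1)) (fun m : ℕ => a - m * η)).smul
        (-(∏ j ∈ s, -sinh (2 * y j)))
      rw [Finset.card_range] at h2
      have := h1.add h2
      simpa only [neg_mul, ← sub_eq_add_neg] using this
    refine hT.eq_zero (insert (-y k0) (s.image y)) ?_ ?_ ?_ u
    · rw [Finset.card_insert_of_notMem hnot, Finset.card_image_of_injOn hinj]; omega
    · have hA : ∀ j ∈ s, sinh (-y k0 - y j) ≠ 0 := by
        intro j hj
        rw [← neg_add', sinh_neg]
        exact neg_ne_zero.2 (hG.2 k0 hk0 j hj)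
      intro u hu v hv huv
      rcases Finset.mem_insert.1 hu with rfl | hu <;> rcases Finset.mem_insert.1 hv with rfl | hv
      · exact absurd rfl huv
      · obtain ⟨j, hj, rfl⟩ := Finset.mem_image.1 hv
        exact hA j hj
      · obtain ⟨j, hj, rfl⟩ := Finset.mem_image.1 hu
        rw [← neg_sub, sinh_neg]
        exact neg_ne_zero.2 (hA j hj)
      · obtain ⟨j, hj, rfl⟩ := Finset.mem_image.1 hv
        obtain ⟨i, hi, rfl⟩ := Finset.mem_image.1 hu
        exact hG.1 i hi j hj (fun h => huv (by rw [h]))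
    · intro u hu
      rcases Finset.mem_insert.1 hu with rfl | hu
      · obtain ⟨s', hks, rfl, hc, hG'⟩ := key k0 hk0
        rw [(S_at η a y s' k0 hks hG).2, ih s' hc hG', Finset.prod_insert hks,
          Finset.prod_range_succ']
        have : ∏ m ∈ Finset.range n, sinh (-y k0 - η + (a - m * η))
            = ∏ m ∈ Finset.range n, sinh (-y k0 + (a - ((m + 1 : ℕ) : ℂ) * η)) :=
          Finset.prod_congr rfl fun m _ => by congr 1; push_cast; ring
        rw [this]
        have e : sinh (-y k0 + (a - ((0 : ℕ) : ℂ) * η)) = sinh (a - y k0) := by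
          congr 1; push_cast; ring
        rw [e]; ring
      · obtain ⟨k, hk, rfl⟩ := Finset.mem_image.1 hu
        obtain ⟨s', hks, rfl, hc, hG'⟩ := key k hk
        rw [(S_at η a y s' k hks hG).1, ih s' hc hG', Finset.prod_insert hks,
          Finset.prod_range_succ']
        have : ∏ m ∈ Finset.range n, sinh (y k - η + (a - m * η))
            = ∏ m ∈ Finset.range n, sinh (y k + (a - ((m + 1 : ℕ) : ℂ) * η)) :=
          Finset.prod_congr rfl fun m _ => by congr 1; push_cast; ring
        rw [this]
        have e : sinh (y k + (a - ((0 : ℕ) : ℂ) * η)) = sinh (a + y k) := by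
          congr 1; push_cast; ring
        rw [e]; ring

/-- coefficients -/
noncomputable def cY {d : ℕ} (η a : ℂ) (y : Fin d → ℂ) (I : Finset (Fin d)) : ℂ :=
  P2 (fun i j => sinh (y i + y j - η) / sinh (y i + y j + η)) I
  * (∏ j ∈ Iᶜ, ∏ j' ∈ I, sinh (y j' - y j - η) * sinh (y j' + y j)
        / (sinh (y j' - y j) * sinh (y j' + y j + η)))
  * ∏ j ∈ I, sinh (a + y j) / sinh (a - y j)

noncomputable def AA {d : ℕ} (η a u : ℂ) (y : Fin d → ℂ) : ℂ :=
  ∑ I : Finset (Fin d), (-1 : ℂ) ^ I.card * (cY η a y I *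
    ((∏ j ∈ I, sinh (u + y j)) * ∏ j ∈ Iᶜ, sinh (u - y j)))

noncomputable def KK {d : ℕ} (η a : ℂ) (y : Fin d → ℂ) : ℂ :=
  (∏ j, sinh (a - y j)) * P2 (fun i j => sinh (y i + y j + η)) Finset.univ

lemma pair_id {d : ℕ} (η : ℂ) (y : Fin d → ℂ) (hG : Gen y Finset.univ)
    (h' : ∀ i j, i ≠ j → sinh (y i + y j + η) ≠ 0) (I : Finset (Fin d)) :
    P2 (fun i j => sinh (y i + y j - η) / sinh (y i + y j + η)) I
      * (∏ j ∈ Iᶜ, ∏ j' ∈ I, sinh (y j' - y j - η) * sinh (y j' + y j)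
        / (sinh (y j' - y j) * sinh (y j' + y j + η))) * P2 (G η y) Finset.univ
      = P2 (G η (flip I y)) Finset.univ := by
  rw [← Finset.union_compl I, P2_union _ (G_symm η _) _ _ disjoint_compl_right,
    P2_union _ (G_symm η _) _ _ disjoint_compl_right]
  have e1 : P2 (fun i j => sinh (y i + y j - η) / sinh (y i + y j + η)) I * P2 (G η y) I
      = P2 (G η (flip I y)) I := by
    rw [P2_mul]
    refine P2_congr fun i hi j hj hij => ?_
    have h1 := h' i j hij
    have h2 := hG.2 i (by simp) j (by simp)
    simp only [G, flip, hi, hj, if_true]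
    have e : sinh (-y i + -y j + η) = - sinh (y i + y j - η) := by
      rw [← sinh_neg]; congr 1; ring
    rw [e, ← neg_add, sinh_neg]; field_simp
  have e2 : P2 (G η y) Iᶜ = P2 (G η (flip I y)) Iᶜ := by
    refine P2_congr fun i hi j hj hij => ?_
    simp only [Finset.mem_compl] at hi hj
    simp only [G, flip, hi, hj, if_false]
  have e3 : (∏ j ∈ Iᶜ, ∏ j' ∈ I, sinh (y j' - y j - η) * sinh (y j' + y j)
        / (sinh (y j' - y j) * sinh (y j' + y j + η))) * ∏ j ∈ Iᶜ, ∏ j' ∈ I, G η y j' j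
      = ∏ j ∈ Iᶜ, ∏ j' ∈ I, G η (flip I y) j' j := by
    rw [← Finset.prod_mul_distrib]
    refine Finset.prod_congr rfl fun j hj => ?_
    rw [← Finset.prod_mul_distrib]
    refine Finset.prod_congr rfl fun i hi => ?_
    simp only [Finset.mem_compl] at hj
    have hij : i ≠ j := fun h => hj (h ▸ hi)
    have h1 := h' i j hij
    have h2 := hG.2 i (by simp) j (by simp)
    have h3 := hG.1 i (by simp) j (by simp) hij
    simp only [G, flip, hi, hj, if_true, if_false]
    have e : sinh (-y i + y j + η) = - sinh (y i - y j - η) := by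
      rw [← sinh_neg]; congr 1; ring
    have e' : sinh (-y i + y j) = - sinh (y i - y j) := by
      rw [← sinh_neg]; congr 1; ring
    rw [e, e']; field_simp
  rw [← e1, ← e2, ← e3]; ring

lemma AA_generic {d : ℕ} (η a u : ℂ) (y : Fin d → ℂ) (hG : Gen y Finset.univ)
    (h' : ∀ i j, i ≠ j → sinh (y i + y j + η) ≠ 0) (ha : ∀ j, sinh (a - y j) ≠ 0) :
    KK η a y * AA η a u y = P2 (fun i j => sinh (y i + y j)) Finset.univ *
      ((∏ j, -sinh (2 * y j)) * ∏ m ∈ Finset.range d, sinh (u + (a - m * η))) := by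
  rw [← S_formula η y d Finset.univ (by simp) hG a u]
  have hK : KK η a y = (∏ j, sinh (a - y j)) * (P2 (fun i j => sinh (y i + y j)) Finset.univ *
      P2 (G η y) Finset.univ) := by
    rw [KK, P2_mul]
    congr 1
    refine P2_congr fun i _ j _ hij => ?_
    have h2 := hG.2 i (by simp) j (by simp)
    unfold G; field_simp
  rw [hK, AA, S, Finset.powerset_univ, Finset.mul_sum, Finset.mul_sum]
  refine Finset.sum_congr rfl fun I _ => ?_
  rw [← pair_id η y hG h' I, cY, Finset.prod_mul_distrib]
  have e1 : (∏ j, sinh (a - y j)) * (∏ j ∈ I, sinh (a + y j) / sinh (a - y j))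
      = ∏ j, sinh (a - flip I y j) := by
    rw [← Finset.prod_mul_prod_compl I, ← Finset.prod_mul_prod_compl I (fun j => sinh (a - flip I y j)),
      mul_right_comm, ← Finset.prod_mul_distrib]
    congr 1
    · refine Finset.prod_congr rfl fun j hj => ?_
      have := ha j
      simp only [flip, hj, if_true, sub_neg_eq_add]; field_simp
    · refine Finset.prod_congr rfl fun j hj => ?_
      simp only [Finset.mem_compl] at hj
      simp only [flip, hj, if_false]
  have e2 : ((∏ j ∈ I, sinh (u + y j)) * ∏ j ∈ Iᶜ, sinh (u - y j))
      = ∏ j, sinh (u - flip I y j) := by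
    rw [← Finset.prod_mul_prod_compl I (fun j => sinh (u - flip I y j))]
    congr 1
    · refine Finset.prod_congr rfl fun j hj => ?_
      simp only [flip, hj, if_true, sub_neg_eq_add]
    · refine Finset.prod_congr rfl fun j hj => ?_
      simp only [Finset.mem_compl] at hj
      simp only [flip, hj, if_false]
  rw [← e1, e2]; ring

open Filter Topology in
lemma sinh_event {b c : ℂ} (hc : c ≠ 0) : ∀ᶠ r in 𝓝[≠] (0 : ℂ), sinh (b + c * r) ≠ 0 := by
  have han : AnalyticAt ℂ (fun r : ℂ => sinh (b + c * r)) 0 := by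
    have : Differentiable ℂ (fun r : ℂ => sinh (b + c * r)) := by fun_prop
    exact this.analyticAt 0
  rcases han.eventually_eq_zero_or_eventually_ne_zero with h | h
  · exfalso
    have h0 : sinh (b + c * 0) = 0 := h.self_of_nhds
    have hd : HasDerivAt (fun r : ℂ => sinh (b + c * r)) (cosh (b + c * 0) * (c * 1)) 0 :=
      (((hasDerivAt_id (0 : ℂ)).const_mul c).const_add b).csinh
    have hd' : HasDerivAt (fun r : ℂ => sinh (b + c * r)) 0 0 :=
      (hasDerivAt_const (0 : ℂ) (0 : ℂ)).congr_of_eventuallyEq h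
    have := hd.unique hd'
    have hcs : cosh (b + c * 0) = 0 := by simpa [hc] using this
    have := cosh_sq_sub_sinh_sq (b + c * 0)
    rw [h0, hcs] at this
    norm_num at this
  · exact h

open Filter Topology in
lemma AA_formula {d : ℕ} (η a u : ℂ) (y : Fin d → ℂ)
    (h : ∀ i j, i ≠ j → sinh (y i - y j) ≠ 0)
    (h' : ∀ i j, i ≠ j → sinh (y i + y j + η) ≠ 0) (ha : ∀ j, sinh (a - y j) ≠ 0) :
    KK η a y * AA η a u y = P2 (fun i j => sinh (y i + y j)) Finset.univ *
      ((∏ j, -sinh (2 * y j)) * ∏ m ∈ Finset.range d, sinh (u + (a - m * η))) := by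
  let Y : ℂ → Fin d → ℂ := fun r j => y j + r
  have hY0 : Y 0 = y := by funext j; simp [Y]
  have hYc : ∀ j, Continuous fun r => Y r j := fun j => by simp only [Y]; fun_prop
  have cL : ContinuousAt (fun r => KK η a (Y r) * AA η a u (Y r)) 0 := by
    unfold KK AA cY P2
    have q1 : ∀ i j, i ≠ j → sinh (Y 0 i - Y 0 j) ≠ 0 := by rw [hY0]; exact h
    have q2 : ∀ i j, i ≠ j → sinh (Y 0 i + Y 0 j + η) ≠ 0 := by rw [hY0]; exact h'
    have q3 : ∀ j, sinh (a - Y 0 j) ≠ 0 := by rw [hY0]; exact ha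
    refine ContinuousAt.mul (by fun_prop) ?_
    refine tendsto_finsetSum _ fun I _ => ?_
    refine ContinuousAt.mul continuousAt_const (ContinuousAt.mul (ContinuousAt.mul
      (ContinuousAt.mul ?_ ?_) ?_) (by fun_prop))
    · refine tendsto_finsetProd _ fun p hp => ?_
      simp only [Finset.mem_filter, Finset.mem_univ, true_and] at hp
      exact ContinuousAt.div (by fun_prop) (by fun_prop) (q2 _ _ hp.2.2.ne)
    · refine tendsto_finsetProd _ fun j hj => tendsto_finsetProd _ fun i hi => ?_
      have hij : i ≠ j := fun e => (Finset.mem_compl.1 hj) (e ▸ hi)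
      exact ContinuousAt.div (by fun_prop) (by fun_prop) (mul_ne_zero (q1 _ _ hij) (q2 _ _ hij))
    · refine tendsto_finsetProd _ fun j hj => ?_
      exact ContinuousAt.div (by fun_prop) (by fun_prop) (q3 j)
  have cR : ContinuousAt (fun r => P2 (fun i j => sinh (Y r i + Y r j)) Finset.univ *
      ((∏ j, -sinh (2 * Y r j)) * ∏ m ∈ Finset.range d, sinh (u + (a - m * η)))) 0 := by
    unfold P2
    fun_prop
  have ev : ∀ᶠ r in 𝓝[≠] (0 : ℂ), KK η a (Y r) * AA η a u (Y r) =
      P2 (fun i j => sinh (Y r i + Y r j)) Finset.univ *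
      ((∏ j, -sinh (2 * Y r j)) * ∏ m ∈ Finset.range d, sinh (u + (a - m * η))) := by
    have ev1 : ∀ᶠ r in 𝓝[≠] (0 : ℂ), ∀ i j, sinh (y i + y j + 2 * r) ≠ 0 :=
      eventually_all.2 fun i => eventually_all.2 fun j => sinh_event two_ne_zero
    have ev2 : ∀ᶠ r in 𝓝[≠] (0 : ℂ), ∀ i j, sinh (y i + y j + η + 2 * r) ≠ 0 :=
      eventually_all.2 fun i => eventually_all.2 fun j => sinh_event two_ne_zero
    have ev3 : ∀ᶠ r in 𝓝[≠] (0 : ℂ), ∀ j, sinh (a - y j + (-1) * r) ≠ 0 :=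
      eventually_all.2 fun i => sinh_event (by norm_num)
    filter_upwards [ev1, ev2, ev3] with r r1 r2 r3
    refine AA_generic η a u (Y r) ⟨fun i _ j _ hij => ?_, fun i _ j _ => ?_⟩ (fun i j _ => ?_)
      fun j => ?_
    · convert h i j hij using 2; simp [Y]
    · convert r1 i j using 2; simp only [Y]; ring
    · convert r2 i j using 2; simp only [Y]; ring
    · convert r3 j using 2; simp only [Y]; ring
  have t1 := cL.tendsto.mono_left (nhdsWithin_le_nhds (s := {0}ᶜ))
  have t2 := cR.tendsto.mono_left (nhdsWithin_le_nhds (s := {0}ᶜ))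
  have := tendsto_nhds_unique (t1.congr' ev) t2
  simpa only [hY0] using this

lemma F_formula {d : ℕ} (τ η ξ ℓ : ℂ) (x : Fin d → ℂ)
    (hsep : ∀ i j : Fin d, i ≠ j → sinh (x i - x j) ≠ 0)
    (hsep' : ∀ i j : Fin d, i ≠ j → sinh (x i + x j - τ + η) ≠ 0)
    (hξ : ∀ j : Fin d, sinh (ξ - x j + τ / 2 - η / 2) ≠ 0) :
    ∃ C : ℂ, ∀ t, (∀ j : Fin d, sinh (t - x j + τ + ℓ * η) ≠ 0) →
      Ftrig τ η ξ ℓ x t =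
      C * (∏ m ∈ Finset.range d, (sinh (ξ - t - τ / 2 + (ℓ + 1 / 2 - ((m : ℕ) + 1)) * η) *
          sinh (t + τ / 2 + ℓ * η + (ξ - η / 2 - m * η))))
        / ∏ j, (sinh (t - x j + τ + ℓ * η) * sinh (t + x j - ℓ * η)) := by
  set y : Fin d → ℂ := fun j => x j - τ / 2 with hy
  set a : ℂ := ξ - η / 2 with hadef
  have g1 : ∀ i j, i ≠ j → sinh (y i - y j) ≠ 0 := fun i j hij => by
    convert hsep i j hij using 2; simp only [hy]; ring
  have g2 : ∀ i j, i ≠ j → sinh (y i + y j + η) ≠ 0 := fun i j hij => by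
    convert hsep' i j hij using 2; simp only [hy]; ring
  have g3 : ∀ j, sinh (a - y j) ≠ 0 := fun j => by
    convert hξ j using 2; simp only [hy, hadef]; ring
  have hK : KK η a y ≠ 0 := mul_ne_zero (Finset.prod_ne_zero_iff.2 fun j _ => g3 j) (P2_ne g2)
  refine ⟨P2 (fun i j => sinh (y i + y j)) Finset.univ * (∏ j, -sinh (2 * y j)) / KK η a y,
    fun t ht => ?_⟩
  have hA := AA_formula η a (t + τ / 2 + ℓ * η) y g1 g2 g3
  have hprod : (∏ j, sinh (t - x j + τ + ℓ * η)) ≠ 0 := Finset.prod_ne_zero_iff.2 fun j _ => ht j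
  have hsum : (∏ j, sinh (t - x j + τ + ℓ * η)) *
      (∑ I : Finset (Fin d), (-1 : ℂ) ^ I.card * qfact τ η ξ ℓ x t I)
      = AA η a (t + τ / 2 + ℓ * η) y := by
    rw [AA, Finset.mul_sum]
    refine Finset.sum_congr rfl fun I _ => ?_
    have hq : qfact τ η ξ ℓ x t I = cY η a y I *
        ∏ j ∈ I, (sinh (t + τ / 2 + ℓ * η + y j) / sinh (t - x j + τ + ℓ * η)) := by
      unfold qfact cY P2
      rw [mul_assoc _ (∏ j ∈ I, _) (∏ j ∈ I, _), ← Finset.prod_mul_distrib]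
      congr 1
      · congr 1
        · refine Finset.prod_congr rfl fun p _ => ?_
          simp only [hy]
          congr 2 <;> ring
        · refine Finset.prod_congr rfl fun j _ => Finset.prod_congr rfl fun i _ => ?_
          simp only [hy]
          congr 2 <;> congr 1 <;> ring
      · refine Finset.prod_congr rfl fun j _ => ?_
        rw [div_mul_div_comm]
        simp only [hy, hadef]
        congr 2 <;> congr 1 <;> ring
    have hp : (∏ j, sinh (t - x j + τ + ℓ * η)) *
        ∏ j ∈ I, (sinh (t + τ / 2 + ℓ * η + y j) / sinh (t - x j + τ + ℓ * η))
        = (∏ j ∈ I, sinh (t + τ / 2 + ℓ * η + y j)) *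
          ∏ j ∈ Iᶜ, sinh (t + τ / 2 + ℓ * η - y j) := by
      rw [← Finset.prod_mul_prod_compl I, mul_right_comm, ← Finset.prod_mul_distrib]
      congr 1
      · refine Finset.prod_congr rfl fun j _ => ?_
        have := ht j
        field_simp
      · refine Finset.prod_congr rfl fun j _ => ?_
        simp only [hy]; congr 1; ring
    rw [hq, ← hp]; ring
  have hsum' := eq_div_of_mul_eq hprod ((mul_comm _ _).trans hsum)
  have hA' := eq_div_of_mul_eq hK ((mul_comm _ _).trans hA)
  rw [Ftrig, hsum', hA', Finset.prod_mul_distrib, Finset.prod_mul_distrib]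
  simp only [div_eq_mul_inv, mul_inv]
  ring

end TrigId

/-- Lemma (trigident) of the paper: `F(t)` is invariant under `t ↦ −t−τ`. -/
theorem Ftrig_invariance (d : ℕ) (hd : 1 ≤ d) (τ η ξ ℓ t : ℂ) (x : Fin d → ℂ)
    (hsep : ∀ i j : Fin d, i ≠ j → sinh (x i - x j) ≠ 0)
    (hsep' : ∀ i j : Fin d, i ≠ j → sinh (x i + x j - τ + η) ≠ 0)
    (hξ : ∀ j : Fin d, sinh (ξ - x j + τ / 2 - η / 2) ≠ 0)
    (ht1 : ∀ j : Fin d, sinh (t + x j - ℓ * η) ≠ 0)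
    (ht2 : ∀ j : Fin d, sinh (t - x j + τ + ℓ * η) ≠ 0)
    (ht3 : ∀ j : Fin d, sinh (t + τ - x j + ℓ * η) ≠ 0) :
    Ftrig τ η ξ ℓ x (-t - τ) = Ftrig τ η ξ ℓ x t := by
  obtain ⟨C, hC⟩ := TrigId.F_formula τ η ξ ℓ x hsep hsep' hξ
  rw [hC t ht2, hC (-t - τ) (fun j => by
    have := neg_ne_zero.2 (ht1 j)
    rw [← sinh_neg] at this
    convert this using 2; ring)]
  congr 1
  · congr 1
    refine Finset.prod_congr rfl fun m _ => ?_
    rw [mul_comm]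
    congr 2 <;> ring
  · refine Finset.prod_congr rfl fun j _ => ?_
    have e1 : sinh (-t - τ - x j + τ + ℓ * η) = - sinh (t + x j - ℓ * η) := by
      rw [← sinh_neg]; congr 1; ring
    have e2 : sinh (-t - τ + x j - ℓ * η) = - sinh (t - x j + τ + ℓ * η) := by
      rw [← sinh_neg]; congr 1; ring
    rw [e1, e2]; ring
end

section
/- Fix η ∈ ℂ. Let Ř(u) be the 4×4 complex matrix indexed by pairs (a,b) ∈ {1,2}² with Ř(u)_{(1,1),(1,1)} = Ř(u)_{(2,2),(2,2)} = sinh(u+η), Ř(u)_{(1,2),(1,2)} = Ř(u)_{(2,1),(2,1)} = sinh(u), Ř(u)_{(1,2),(2,1)} = Ř(u)_{(2,1),(1,2)} = sinh(η), all other entries zero; let P be the 4×4 permutation matrix with P_{(a,b),(b,a)} = 1; and for ξ ∈ ℂ let K̃^ξ(x) = diag(sinh(ξ+x), sinh(ξ−x)) and K̃₂^ξ(x) = Id₂ ⊗ K̃^ξ(x). Then for all x, ξ ∈ ℂ the partial trace over the second tensor factor satisfies: Tr₂( Ř(2x−2η)·P·K̃₂^ξ(x) ) = sinh(2x)·K̃^ξ(x−η),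 where Tr₂(M) is the 2×2 matrix with entries Tr₂(M)_{a,a'} = Σ_{b∈{1,2}} M_{(a,b),(a',b)}. -/
open Complex Matrix Kronecker

/-- The unnormalized 6-vertex R-matrix `Ř(u)`, indexed by pairs in `{1,2}²`
(modelled by `Fin 2 × Fin 2`). -/
noncomputable def sixVertexR (η u : ℂ) :
    Matrix (Fin 2 × Fin 2) (Fin 2 × Fin 2) ℂ :=
  fun p q =>
    if p = q then (if p.1 = p.2 then sinh (u + η) else sinh u)
    else if p.1 = q.2 ∧ p.2 = q.1 ∧ p.1 ≠ p.2 then sinh η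
    else 0

/-- The permutation matrix `P` on `ℂ²⊗ℂ²`: `P_{(a,b),(b,a)} = 1`. -/
noncomputable def permP : Matrix (Fin 2 × Fin 2) (Fin 2 × Fin 2) ℂ :=
  fun p q => if p.1 = q.2 ∧ p.2 = q.1 then 1 else 0

/-- Cherednik's diagonal K-matrix in cleared-denominator form:
`K̃^ξ(x) = diag(sinh(ξ+x), sinh(ξ−x))`. -/
noncomputable def Ktilde (ξ x : ℂ) : Matrix (Fin 2) (Fin 2) ℂ :=
  Matrix.diagonal (fun i => if i = 0 then sinh (ξ + x) else sinh (ξ - x))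

/-- The partial trace over the second tensor factor:
`Tr₂(M)_{a,a'} = Σ_b M_{(a,b),(a',b)}`. -/
noncomputable def ptrace2 (M : Matrix (Fin 2 × Fin 2) (Fin 2 × Fin 2) ℂ) :
    Matrix (Fin 2) (Fin 2) ℂ :=
  fun a a' => ∑ b : Fin 2, M (a, b) (a', b)

theorem crossing_aux1 (p q η : ℂ) :
    sinh (p - η) * sinh q + sinh η * sinh (q - p) = sinh p * sinh (q - η) := by
  simp only [Complex.sinh_sub]; ring

theorem crossing_aux2 (p q η : ℂ) :
    sinh η * sinh (q + p) + sinh (p - η) * sinh q = sinh p * sinh (q + η) := by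
  simp only [Complex.sinh_sub, Complex.sinh_add]; ring

/-- Boundary crossing symmetry (equation (Kcrossing)) of Cherednik's diagonal
K-matrix, in cleared-denominator form:
`Tr₂(Ř(2x−2η)·P·K̃₂^ξ(x)) = sinh(2x)·K̃^ξ(x−η)`. -/
theorem sixVertex_boundary_crossing (η x ξ : ℂ) :
    ptrace2 (sixVertexR η (2 * x - 2 * η) * permP
        * ((1 : Matrix (Fin 2) (Fin 2) ℂ) ⊗ₖ Ktilde ξ x))
      = sinh (2 * x) • Ktilde ξ (x - η) := by
  have h1 := crossing_aux1 (2 * x) (ξ + x) η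
  have h2 := crossing_aux2 (2 * x) (ξ - x) η
  rw [show ξ + x - 2 * x = ξ - x by ring, show ξ + x - η = ξ + (x - η) by ring] at h1
  rw [show ξ - x + 2 * x = ξ + x by ring, show ξ - x + η = ξ - (x - η) by ring] at h2
  have e : 2 * x - 2 * η + η = 2 * x - η := by ring
  ext a b
  fin_cases a <;> fin_cases b <;>
    simp [ptrace2, Matrix.mul_apply, Fintype.sum_prod_type, Fin.sum_univ_two, sixVertexR, permP,
      Ktilde, Matrix.kroneckerMap_apply, Matrix.one_apply, Matrix.diagonal_apply, e]
  · exact h1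
  · exact h2
end

section
/- Fix ℓ, η, ξ ∈ ℂ with sinh(η) ≠ 0 and sinh(ξ + y + (ℓ+1/2−j)η) ≠ 0 for all integers j ≥ 1 (for the relevant value y below). Let M be the complex vector space with basis (m_n)_{n≥1} (m₀ := 0) and let L̃(x) on ℂ²⊗M be the operator with block matrix [[Ã(x), B̃],[C̃, D̃(x)]], where Ã(x)m_n = sinh(x+(3/2+ℓ−n)η)·m_n, B̃ m_n = sinh(η)·e^{(n−ℓ−1/2)η}·m_{n+1}, C̃ m_n = [sinh((n−1)η)·sinh((2ℓ+2−n)η)/sinh(η)]·e^{(ℓ+3/2−n)η}·m_{n−1}, D̃(x)m_n = sinh(x+(n−ℓ−1/2)η)·m_n. Let K̃^ξ(x) = diag(sinh(ξ+x), sinh(ξ−x)) act on ℂ², with K̃₁^ξ(x) = K̃^ξ(x)⊗Id_M, and let 𝒦^{ξ,ℓ}(y) be the diagonal operator on M with 𝒦^{ξ,ℓ}(y)m_n = C_n^ℓ(y;ξ)·m_n, where C_n^ℓ(y;ξ) := ∏_{j=1}^{n−1} sinh(ξ−y+(ℓ+1/2−j)η)/sinh(ξ+y+(ℓ+1/2−j)η)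 and C₁^ℓ = 1; set 𝒦₂(y) = Id_{ℂ²}⊗𝒦^{ξ,ℓ}(y). Then for all x, y ∈ ℂ: L̃(x−y)·K̃₁^ξ(x)·L̃(x+y)·𝒦₂(y) = 𝒦₂(y)·L̃(x+y)·K̃₁^ξ(x)·L̃(x−y) as operators on ℂ²⊗M. -/
open Complex

/-- The diagonal block `Ã(x)`: `Ã(x) m_n = sinh(x+(3/2+ℓ−n)η)·m_n`. Vectors of the
Verma-type module `M` with basis `(m_n)_{n ≥ 1}` are modelled by coordinate
functions `ℕ+ → ℂ`. -/
noncomputable def Aop (ℓ η x : ℂ) (f : ℕ+ → ℂ) : ℕ+ → ℂ :=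
  fun n => sinh (x + (3 / 2 + ℓ - ((n : ℕ) : ℂ)) * η) * f n

/-- The raising block `B̃`: `B̃ m_n = sinh(η)·e^{(n−ℓ−1/2)η}·m_{n+1}`, in coordinates. -/
noncomputable def Bop (ℓ η : ℂ) (f : ℕ+ → ℂ) : ℕ+ → ℂ :=
  fun n =>
    if 1 < (n : ℕ) then
      sinh η * Complex.exp ((((n : ℕ) : ℂ) - 1 - ℓ - 1 / 2) * η) * f (n - 1)
    else 0

/-- The lowering block `C̃`:
`C̃ m_n = [sinh((n−1)η)·sinh((2ℓ+2−n)η)/sinh(η)]·e^{(ℓ+3/2−n)η}·m_{n−1}` (`m₀ := 0`),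
in coordinates. -/
noncomputable def Cop (ℓ η : ℂ) (f : ℕ+ → ℂ) : ℕ+ → ℂ :=
  fun n =>
    sinh (((n : ℕ) : ℂ) * η) * sinh ((2 * ℓ + 1 - ((n : ℕ) : ℂ)) * η) / sinh η
      * Complex.exp ((ℓ + 1 / 2 - ((n : ℕ) : ℂ)) * η) * f (n + 1)

/-- The diagonal block `D̃(x)`: `D̃(x) m_n = sinh(x+(n−ℓ−1/2)η)·m_n`. -/
noncomputable def Dop (ℓ η x : ℂ) (f : ℕ+ → ℂ) : ℕ+ → ℂ :=
  fun n => sinh (x + (((n : ℕ) : ℂ) - ℓ - 1 / 2) * η) * f n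

/-- The unnormalized spin-½ L-operator `L̃(x)` on `ℂ²⊗M`, with block matrix
`[[Ã(x), B̃],[C̃, D̃(x)]]`. -/
noncomputable def Lop (ℓ η x : ℂ) (f : Fin 2 × ℕ+ → ℂ) : Fin 2 × ℕ+ → ℂ :=
  fun p =>
    if p.1 = 0 then
      Aop ℓ η x (fun n => f (0, n)) p.2 + Bop ℓ η (fun n => f (1, n)) p.2
    else
      Cop ℓ η (fun n => f (0, n)) p.2 + Dop ℓ η x (fun n => f (1, n)) p.2

/-- Cherednik's diagonal K-matrix `K̃^ξ(x) = diag(sinh(ξ+x), sinh(ξ−x))` acting in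
the auxiliary (first) factor of `ℂ²⊗M`. -/
noncomputable def K1op (ξ x : ℂ) (f : Fin 2 × ℕ+ → ℂ) : Fin 2 × ℕ+ → ℂ :=
  fun p => (if p.1 = 0 then sinh (ξ + x) else sinh (ξ - x)) * f p

/-- The eigenvalue `C_n^ℓ(y;ξ) = ∏_{j=1}^{n−1} sinh(ξ−y+(ℓ+1/2−j)η)/sinh(ξ+y+(ℓ+1/2−j)η)`
of the diagonal higher-spin K-operator (`C₁ = 1`). -/
noncomputable def Ceig (ℓ η ξ y : ℂ) (n : ℕ) : ℂ :=
  ∏ j ∈ Finset.range (n - 1),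
    sinh (ξ - y + (ℓ + 1 / 2 - ((j : ℕ) + 1)) * η)
      / sinh (ξ + y + (ℓ + 1 / 2 - ((j : ℕ) + 1)) * η)

/-- The diagonal higher-spin K-operator `𝒦^{ξ,ℓ}(y)` acting in the state (second)
factor of `ℂ²⊗M`: `𝒦^{ξ,ℓ}(y) m_n = C_n^ℓ(y;ξ)·m_n`. -/
noncomputable def K2op (ℓ η ξ y : ℂ) (f : Fin 2 × ℕ+ → ℂ) : Fin 2 × ℕ+ → ℂ :=
  fun p => Ceig ℓ η ξ y ((p.2 : ℕ)) * f p

theorem key_sinh (ξ x z : ℂ) :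
    sinh (ξ + x) * sinh (x - z) + sinh (ξ - x) * sinh (x + z)
      = sinh (2 * x) * sinh (ξ - z) := by
  have h1 := Complex.cosh_sq x
  simp only [Complex.sinh_add, Complex.sinh_sub, Complex.sinh_two_mul]
  ring

theorem Ceig_succ (ℓ η ξ y : ℂ)
    (hy : ∀ j : ℕ, 1 ≤ j → sinh (ξ + y + (ℓ + 1 / 2 - (j : ℂ)) * η) ≠ 0)
    (n : ℕ) (hn : 1 ≤ n) :
    Ceig ℓ η ξ y (n + 1) * sinh (ξ + y + (ℓ + 1 / 2 - (n : ℂ)) * η)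
      = Ceig ℓ η ξ y n * sinh (ξ - y + (ℓ + 1 / 2 - (n : ℂ)) * η) := by
  obtain ⟨m, rfl⟩ : ∃ m, n = m + 1 := ⟨n - 1, by omega⟩
  have h := hy (m + 1) hn
  unfold Ceig
  simp only [Nat.add_sub_cancel, Finset.prod_range_succ]
  push_cast at h ⊢
  rw [mul_assoc, div_mul_cancel₀ _ h]

theorem exch (ℓ η ξ y x : ℂ)
    (hy : ∀ j : ℕ, 1 ≤ j → sinh (ξ + y + (ℓ + 1 / 2 - (j : ℂ)) * η) ≠ 0)
    (n : ℕ) (hn : 1 ≤ n) (a : ℂ) (ha : a = (ℓ + 1 / 2 - (n : ℂ)) * η) :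
    Ceig ℓ η ξ y (n + 1) *
        (sinh (ξ + x) * sinh (x + y + a) + sinh (ξ - x) * sinh (x - y - a))
      = Ceig ℓ η ξ y n *
        (sinh (ξ + x) * sinh (x - y + a) + sinh (ξ - x) * sinh (x + y - a)) := by
  have h := Ceig_succ ℓ η ξ y hy n hn
  rw [← ha] at h
  have h1 := key_sinh ξ x (-(y + a))
  have h2 := key_sinh ξ x (y - a)
  rw [show x - -(y + a) = x + y + a by ring, show x + -(y + a) = x - y - a by ring,
    show ξ - -(y + a) = ξ + y + a by ring] at h1
  rw [show x - (y - a) = x - y + a by ring, show x + (y - a) = x + y - a by ring,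
    show ξ - (y - a) = ξ - y + a by ring] at h2
  rw [h1, h2]
  linear_combination sinh (2 * x) * h

/-- The mixed reflection equation (equation (reVM) with `k = ½`, the spin-½
specialization of Proposition Kdiagonalprop) between Cherednik's spin-½ K-matrix
and the diagonal higher-spin K-operator `𝒦^{ξ,ℓ}(y)`, with the unnormalized
spin-½ L-operator:
`L̃(x−y)·K̃₁^ξ(x)·L̃(x+y)·𝒦₂(y) = 𝒦₂(y)·L̃(x+y)·K̃₁^ξ(x)·L̃(x−y)` on `ℂ²⊗M`. -/
theorem mixed_reflection_equation (ℓ η ξ : ℂ) (hη : sinh η ≠ 0) (x y : ℂ)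
    (hy : ∀ j : ℕ, 1 ≤ j → sinh (ξ + y + (ℓ + 1 / 2 - (j : ℂ)) * η) ≠ 0) :
    ∀ f : Fin 2 × ℕ+ → ℂ,
      Lop ℓ η (x - y) (K1op ξ x (Lop ℓ η (x + y) (K2op ℓ η ξ y f)))
        = K2op ℓ η ξ y (Lop ℓ η (x + y) (K1op ξ x (Lop ℓ η (x - y) f))) := by
  intro f
  funext p
  obtain ⟨i, n⟩ := p
  fin_cases i
  · rcases eq_or_ne n 1 with rfl | hn
    · simp [Lop, K1op, K2op, Aop, Bop]
      ring
    · obtain ⟨m, rfl⟩ := PNat.exists_eq_succ_of_ne_one hn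
      have e := exch ℓ η ξ y x hy m m.pos _ rfl
      have h1 : (m + 1 : ℕ+) - 1 = m := by
        apply PNat.eq
        rw [PNat.sub_coe, if_pos (by exact PNat.lt_add_left 1 m)]
        simp
      have h2 : 1 < (m : ℕ) + 1 := by
        have := m.pos
        omega
      simp only [Lop, K1op, K2op, Aop, Bop, Cop, Dop, h1, if_pos h2, Fin.mk_zero, Fin.zero_eta,
        Fin.isValue, if_true, one_ne_zero, if_false, PNat.add_coe, PNat.one_coe, Nat.cast_add,
        Nat.cast_one]
      rw [show x - y + (3 / 2 + ℓ - ((m : ℕ) + 1 : ℂ)) * η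
          = x - y + (ℓ + 1 / 2 - ((m : ℕ) : ℂ)) * η by ring,
        show x + y + (3 / 2 + ℓ - ((m : ℕ) + 1 : ℂ)) * η
          = x + y + (ℓ + 1 / 2 - ((m : ℕ) : ℂ)) * η by ring,
        show x - y + (((m : ℕ) : ℂ) - ℓ - 1 / 2) * η
          = x - y - (ℓ + 1 / 2 - ((m : ℕ) : ℂ)) * η by ring,
        show x + y + (((m : ℕ) : ℂ) - ℓ - 1 / 2) * η
          = x + y - (ℓ + 1 / 2 - ((m : ℕ) : ℂ)) * η by ring]
      linear_combination (-(sinh η *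
        Complex.exp ((((m : ℕ) : ℂ) + 1 - 1 - ℓ - 1 / 2) * η) * f (1, m))) * e
  · have e := exch ℓ η ξ y x hy n n.pos _ rfl
    have h1 : (n + 1 : ℕ+) - 1 = n := by
      apply PNat.eq
      rw [PNat.sub_coe, if_pos (by exact PNat.lt_add_left 1 n)]
      simp
    have h3 : 1 < (n : ℕ) + 1 := by
      have := n.pos
      omega
    simp only [Lop, K1op, K2op, Aop, Bop, Cop, Dop, h1, Fin.mk_one,
      Fin.isValue, if_true, one_ne_zero, if_false, PNat.add_coe, PNat.one_coe, Nat.cast_add,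
      Nat.cast_one, if_pos h3]
    rw [show x - y + (3 / 2 + ℓ - ((n : ℕ) + 1 : ℂ)) * η
        = x - y + (ℓ + 1 / 2 - ((n : ℕ) : ℂ)) * η by ring,
      show x + y + (3 / 2 + ℓ - ((n : ℕ) + 1 : ℂ)) * η
        = x + y + (ℓ + 1 / 2 - ((n : ℕ) : ℂ)) * η by ring,
      show x - y + (((n : ℕ) : ℂ) - ℓ - 1 / 2) * η
        = x - y - (ℓ + 1 / 2 - ((n : ℕ) : ℂ)) * η by ring,
      show x + y + (((n : ℕ) : ℂ) - ℓ - 1 / 2) * η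
        = x + y - (ℓ + 1 / 2 - ((n : ℕ) : ℂ)) * η by ring]
    linear_combination (sinh (((n : ℕ) : ℂ) * η) * sinh ((2 * ℓ + 1 - ((n : ℕ) : ℂ)) * η) / sinh η
      * Complex.exp ((ℓ + 1 / 2 - ((n : ℕ) : ℂ)) * η) * f (0, n + 1)) * e
end

section
/- Fix η ∈ ℂ with sinh(η) ≠ 0, and let k be a nonnegative half-integer (2k ∈ ℤ≥0). For a nonnegative half-integer m, let V^m be the complex vector space with basis v₁^m,…,v_{2m+1}^m (convention v₀^m = v_{2m+2}^m = 0), and define the evaluation action of the generators of quantum affine sl₂ on V^m(x) by: e₁·v_n = e^{−x}·[sinh((n−1)η)sinh((2m+2−n)η)/sinh(η)²]·v_{n−1}, f₁·v_n = e^{x}·v_{n+1}, e₀·v_n = e^{−x}·v_{n+1}, f₀·v_n = e^{x}·[sinh((n−1)η)sinh((2m+2−n)η)/sinh(η)²]·v_{n−1}, and p^{λh₁}·v_n = e^{2λη(m+1−n)}·v_n for λ ∈ ℂ. On a tensor product V(x)⊗V'(y) of two such evaluation representations, let the generators act by the coproduct: e_i ↦ e_i⊗1 + p^{−h_i}⊗e_i,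 f_i ↦ f_i⊗p^{h_i} + 1⊗f_i, p^{λh₁} ↦ p^{λh₁}⊗p^{λh₁}, where p^{λh₀} := p^{−λh₁}. Define ι^k: V^{k+1/2} → V^{1/2}⊗V^k by ι^k(v_n^{k+1/2}) = e^{η(n−1)/2}·v₁^{1/2}⊗v_n^k + e^{−η(n−2−2k)/2}·[sinh((n−1)η)/sinh(η)]·v₂^{1/2}⊗v_{n−1}^k for 1 ≤ n ≤ 2k+2. Then for every x ∈ ℂ and every generator g ∈ {e₀, e₁, f₀, f₁} ∪ {p^{λh₁} : λ ∈ ℂ}, the map ι^k intertwines the action of g on V^{k+1/2}(x) with the coproduct action of g on V^{1/2}(x−kη)⊗V^k(x+η/2): ι^k(g·v) = g·ι^k(v) for all v ∈ V^{k+1/2}. -/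
open Complex

/- The evaluation representation `V^m(x)` of quantum affine sl₂, where `m = M/2`
is a nonnegative half-integer: the space is `Fin (M+1) → ℂ` (coordinates with
respect to the weight basis `v_1,…,v_{M+1}`, index `i ↔ v_{i+1}`), and the
generators act by the formulas of the paper. All operators are written in
"pull" (coordinate) form. -/

/-- `e₁·v_n = e^{−x}·[sinh((n−1)η)sinh((2m+2−n)η)/sinh(η)²]·v_{n−1}`. -/
noncomputable def actE1 (η x : ℂ) (M : ℕ) (f : Fin (M + 1) → ℂ) : Fin (M + 1) → ℂ :=
  fun i =>
    if h : (i : ℕ) + 1 < M + 1 then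
      Complex.exp (-x)
        * (sinh ((((i : ℕ) : ℂ) + 1) * η) * sinh (((M : ℂ) - ((i : ℕ) : ℂ)) * η)
            / sinh η ^ 2)
        * f ⟨(i : ℕ) + 1, h⟩
    else 0

/-- `f₁·v_n = e^{x}·v_{n+1}`. -/
noncomputable def actF1 (η x : ℂ) (M : ℕ) (f : Fin (M + 1) → ℂ) : Fin (M + 1) → ℂ :=
  fun i =>
    if 0 < (i : ℕ) then
      Complex.exp x * f ⟨(i : ℕ) - 1, lt_of_le_of_lt (Nat.sub_le _ _) i.isLt⟩
    else 0

/-- `e₀·v_n = e^{−x}·v_{n+1}`. -/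
noncomputable def actE0 (η x : ℂ) (M : ℕ) (f : Fin (M + 1) → ℂ) : Fin (M + 1) → ℂ :=
  fun i =>
    if 0 < (i : ℕ) then
      Complex.exp (-x) * f ⟨(i : ℕ) - 1, lt_of_le_of_lt (Nat.sub_le _ _) i.isLt⟩
    else 0

/-- `f₀·v_n = e^{x}·[sinh((n−1)η)sinh((2m+2−n)η)/sinh(η)²]·v_{n−1}`. -/
noncomputable def actF0 (η x : ℂ) (M : ℕ) (f : Fin (M + 1) → ℂ) : Fin (M + 1) → ℂ :=
  fun i =>
    if h : (i : ℕ) + 1 < M + 1 then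
      Complex.exp x
        * (sinh ((((i : ℕ) : ℂ) + 1) * η) * sinh (((M : ℂ) - ((i : ℕ) : ℂ)) * η)
            / sinh η ^ 2)
        * f ⟨(i : ℕ) + 1, h⟩
    else 0

/-- `p^{λh₁}·v_n = e^{2λη(m+1−n)}·v_n`. -/
noncomputable def actH1 (η lam : ℂ) (M : ℕ) (f : Fin (M + 1) → ℂ) : Fin (M + 1) → ℂ :=
  fun i => Complex.exp (2 * lam * η * ((M : ℂ) / 2 - ((i : ℕ) : ℂ))) * f i

/- The coproduct action on a tensor product `V^{m₁}(x₁) ⊗ V^{m₂}(x₂)`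
(space `Fin (M₁+1) × Fin (M₂+1) → ℂ`):
`Δ(e_i) = e_i⊗1 + p^{−h_i}⊗e_i`, `Δ(f_i) = f_i⊗p^{h_i} + 1⊗f_i`,
`Δ(p^{λh₁}) = p^{λh₁}⊗p^{λh₁}`, with `p^{λh₀} = p^{−λh₁}`. -/

/-- `Δ(e₁) = e₁⊗1 + p^{−h₁}⊗e₁` on the tensor product. -/
noncomputable def tensE1 (η x₁ x₂ : ℂ) (M₁ M₂ : ℕ)
    (f : Fin (M₁ + 1) × Fin (M₂ + 1) → ℂ) : Fin (M₁ + 1) × Fin (M₂ + 1) → ℂ :=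
  fun p =>
    actE1 η x₁ M₁ (fun i => f (i, p.2)) p.1
      + Complex.exp (-(2 * η * ((M₁ : ℂ) / 2 - ((p.1 : ℕ) : ℂ))))
          * actE1 η x₂ M₂ (fun j => f (p.1, j)) p.2

/-- `Δ(f₁) = f₁⊗p^{h₁} + 1⊗f₁` on the tensor product. -/
noncomputable def tensF1 (η x₁ x₂ : ℂ) (M₁ M₂ : ℕ)
    (f : Fin (M₁ + 1) × Fin (M₂ + 1) → ℂ) : Fin (M₁ + 1) × Fin (M₂ + 1) → ℂ :=
  fun p =>
    Complex.exp (2 * η * ((M₂ : ℂ) / 2 - ((p.2 : ℕ) : ℂ)))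
        * actF1 η x₁ M₁ (fun i => f (i, p.2)) p.1
      + actF1 η x₂ M₂ (fun j => f (p.1, j)) p.2

/-- `Δ(e₀) = e₀⊗1 + p^{−h₀}⊗e₀ = e₀⊗1 + p^{h₁}⊗e₀` on the tensor product. -/
noncomputable def tensE0 (η x₁ x₂ : ℂ) (M₁ M₂ : ℕ)
    (f : Fin (M₁ + 1) × Fin (M₂ + 1) → ℂ) : Fin (M₁ + 1) × Fin (M₂ + 1) → ℂ :=
  fun p =>
    actE0 η x₁ M₁ (fun i => f (i, p.2)) p.1
      + Complex.exp (2 * η * ((M₁ : ℂ) / 2 - ((p.1 : ℕ) : ℂ)))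
          * actE0 η x₂ M₂ (fun j => f (p.1, j)) p.2

/-- `Δ(f₀) = f₀⊗p^{h₀} + 1⊗f₀ = f₀⊗p^{−h₁} + 1⊗f₀` on the tensor product. -/
noncomputable def tensF0 (η x₁ x₂ : ℂ) (M₁ M₂ : ℕ)
    (f : Fin (M₁ + 1) × Fin (M₂ + 1) → ℂ) : Fin (M₁ + 1) × Fin (M₂ + 1) → ℂ :=
  fun p =>
    Complex.exp (-(2 * η * ((M₂ : ℂ) / 2 - ((p.2 : ℕ) : ℂ))))
        * actF0 η x₁ M₁ (fun i => f (i, p.2)) p.1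
      + actF0 η x₂ M₂ (fun j => f (p.1, j)) p.2

/-- `Δ(p^{λh₁}) = p^{λh₁}⊗p^{λh₁}` on the tensor product. -/
noncomputable def tensH1 (η lam : ℂ) (M₁ M₂ : ℕ)
    (f : Fin (M₁ + 1) × Fin (M₂ + 1) → ℂ) : Fin (M₁ + 1) × Fin (M₂ + 1) → ℂ :=
  fun p =>
    Complex.exp (2 * lam * η * ((M₁ : ℂ) / 2 - ((p.1 : ℕ) : ℂ)))
      * Complex.exp (2 * lam * η * ((M₂ : ℂ) / 2 - ((p.2 : ℕ) : ℂ))) * f p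

/-- The linear map `ι^k : V^{k+1/2} → V^{1/2}⊗V^k` (with `k = K/2`):
`ι^k(v_n^{k+1/2}) = e^{η(n−1)/2}·v₁^{1/2}⊗v_n^k
  + e^{−η(n−2−2k)/2}·[sinh((n−1)η)/sinh(η)]·v₂^{1/2}⊗v_{n−1}^k`. -/
noncomputable def iotaMap (η : ℂ) (K : ℕ) (f : Fin (K + 2) → ℂ) :
    Fin 2 × Fin (K + 1) → ℂ :=
  fun p =>
    if p.1 = 0 then
      Complex.exp (η * ((p.2 : ℕ) : ℂ) / 2) * f (Fin.castSucc p.2)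
    else
      Complex.exp (η * ((K : ℂ) - ((p.2 : ℕ) : ℂ)) / 2)
        * (sinh ((((p.2 : ℕ) : ℂ) + 1) * η) / sinh η) * f (Fin.succ p.2)

lemma sh_a (η a : ℂ) : sinh ((a + 1) * η) = exp (-(a * η)) * sinh η + exp η * sinh (a * η) := by
  simp only [Complex.sinh, add_mul, one_mul, neg_add, exp_add, exp_neg]
  field_simp
  ring

lemma sh_b (η a : ℂ) : sinh ((a + 1) * η) = exp (a * η) * sinh η + exp (-η) * sinh (a * η) := by
  simp only [Complex.sinh, add_mul, one_mul, neg_add, exp_add, exp_neg]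
  field_simp
  ring

lemma alg_e1 {S A B F u y P Q c d r s t : ℂ} (hS : S ≠ 0) (e1 : u * y * P = c * d)
    (e2 : u * y * Q = r * s * t) :
    u * (y * (A * (P * S + Q * B) / S ^ 2) * F)
      = c * (S * S / S ^ 2) * (d * (A / S) * F) + r * (s * (A * B / S ^ 2) * (t * F)) := by
  field_simp
  linear_combination A * F * (S * e1 + B * e2)

lemma alg_f0 {S A B F u y P Q c d r s t : ℂ} (hS : S ≠ 0) (e1 : u * y * P = r * c * d)
    (e2 : u * y * Q = s * t) :
    u * (y * (A * (P * S + Q * B) / S ^ 2) * F)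
      = r * (c * (S * S / S ^ 2) * (d * (A / S) * F)) + s * (A * B / S ^ 2) * (t * F) := by
  field_simp
  linear_combination A * F * (S * e1 + B * e2)

lemma alg_f1 {S B F u y P Q a b c d e : ℂ} (hS : S ≠ 0) (e1 : u * y * P = a * b * c)
    (e2 : u * y * Q = d * e) :
    u * ((P * S + Q * B) / S) * (y * F)
      = a * (b * (c * F)) + d * (e * (B / S) * F) := by
  field_simp
  linear_combination F * (S * e1 + B * e2)

lemma alg_e0 {S B F u y P Q a b c d e : ℂ} (hS : S ≠ 0) (e1 : u * y * P = a * b)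
    (e2 : u * y * Q = c * d * e) :
    u * ((P * S + Q * B) / S) * (y * F)
      = a * (b * F) + c * (d * (e * (B / S) * F)) := by
  field_simp
  linear_combination F * (S * e1 + B * e2)

/-- Proposition (intertwiners)(i) of the paper: `ι^k` intertwines the action of
every generator `g ∈ {e₀,e₁,f₀,f₁} ∪ {p^{λh₁}}` on `V^{k+1/2}(x)` with the
coproduct action on `V^{1/2}(x−kη) ⊗ V^k(x+η/2)`, where `k = K/2`. -/
theorem iota_intertwiner (η : ℂ) (hη : sinh η ≠ 0) (K : ℕ) (x : ℂ) :
    (∀ f : Fin (K + 2) → ℂ,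
        iotaMap η K (actE1 η x (K + 1) f)
          = tensE1 η (x - ((K : ℂ) / 2) * η) (x + η / 2) 1 K (iotaMap η K f))
    ∧ (∀ f : Fin (K + 2) → ℂ,
        iotaMap η K (actF1 η x (K + 1) f)
          = tensF1 η (x - ((K : ℂ) / 2) * η) (x + η / 2) 1 K (iotaMap η K f))
    ∧ (∀ f : Fin (K + 2) → ℂ,
        iotaMap η K (actE0 η x (K + 1) f)
          = tensE0 η (x - ((K : ℂ) / 2) * η) (x + η / 2) 1 K (iotaMap η K f))
    ∧ (∀ f : Fin (K + 2) → ℂ,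
        iotaMap η K (actF0 η x (K + 1) f)
          = tensF0 η (x - ((K : ℂ) / 2) * η) (x + η / 2) 1 K (iotaMap η K f))
    ∧ (∀ (lam : ℂ) (f : Fin (K + 2) → ℂ),
        iotaMap η K (actH1 η lam (K + 1) f)
          = tensH1 η lam 1 K (iotaMap η K f)) := by
  refine ⟨?_, ?_, ?_, ?_, ?_⟩
  · intro f
    funext ⟨a, j, hj⟩
    fin_cases a
    · by_cases h : j < K
      · have hs := sh_b η ((K : ℂ) - j)
        have hc : (K : ℂ) - j + 1 = K + 1 - j := by ring
        rw [hc] at hs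
        simp [iotaMap, actE1, tensE1, h]
        rw [dif_pos h.le, hs]
        refine alg_e1 hη ?_ ?_ <;> (simp only [← exp_add]; congr 1; ring)
      · obtain rfl : j = K := by omega
        simp [iotaMap, actE1, tensE1]
        have e : exp (η * j / 2) * exp (-x) = exp ((j : ℂ) / 2 * η - x) := by simp only [← exp_add]; congr 1; ring
        field_simp at e ⊢
        linear_combination (sinh (η * (j + 1)) * f ⟨j + 1, by omega⟩) * e
    · by_cases h : j < K
      · simp [iotaMap, actE1, tensE1, h]
        have e : exp (η * ((K : ℂ) - j) / 2) * exp (-x) = exp (-(2 * η * (2⁻¹ - 1))) * exp (-(η / 2) + -x) * exp (η * ((K : ℂ) - (j + 1)) / 2) := by simp only [← exp_add]; congr 1; ring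
        linear_combination (sinh ((j + 1) * η) / sinh η * (sinh ((j + 1 + 1) * η)
          * sinh ((K - j) * η) / sinh η ^ 2) * f ⟨j + 1 + 1, by omega⟩) * e
      · obtain rfl : j = K := by omega
        simp [iotaMap, actE1, tensE1]
  · intro f
    funext ⟨a, j, hj⟩
    fin_cases a <;> rcases j with _ | j
    · simp [iotaMap, actF1, tensF1]
    · simp [iotaMap, actF1, tensF1]
      have e : exp (η * ((j : ℂ) + 1) / 2) * exp x = exp (x + η / 2) * exp (η * j / 2) := by simp only [← exp_add]; congr 1; ring
      linear_combination f ⟨j, by omega⟩ * e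
    · simp [iotaMap, actF1, tensF1]
      have e : exp (η * K / 2) * exp x = exp (2 * η * ((K : ℂ) / 2)) * exp (x - (K : ℂ) / 2 * η) := by simp only [← exp_add]; congr 1; ring
      rw [div_self hη]
      linear_combination f 0 * e
    · have hs := sh_a η ((j : ℂ) + 1)
      simp [iotaMap, actF1, tensF1]
      rw [hs]
      refine alg_f1 hη ?_ ?_ <;> (simp only [← exp_add]; congr 1; ring)
  · intro f
    funext ⟨a, j, hj⟩
    fin_cases a <;> rcases j with _ | j
    · simp [iotaMap, actE0, tensE0]
    · simp [iotaMap, actE0, tensE0]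
      have e : exp (η * ((j : ℂ) + 1) / 2) * exp (-x) = exp (2 * η * 2⁻¹) * exp (-(η / 2) + -x) * exp (η * j / 2) := by simp only [← exp_add]; congr 1; ring
      linear_combination f ⟨j, by omega⟩ * e
    · simp [iotaMap, actE0, tensE0]
      have e : exp (η * K / 2) * exp (-x) = exp ((K : ℂ) / 2 * η - x) := by simp only [← exp_add]; congr 1; ring
      rw [div_self hη]
      linear_combination f 0 * e
    · have hs := sh_b η ((j : ℂ) + 1)
      simp [iotaMap, actE0, tensE0]
      rw [hs]
      refine alg_e0 hη ?_ ?_ <;> (simp only [← exp_add]; congr 1; ring)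
  · intro f
    funext ⟨a, j, hj⟩
    fin_cases a
    · by_cases h : j < K
      · have hs := sh_a η ((K : ℂ) - j)
        have hc : (K : ℂ) - j + 1 = K + 1 - j := by ring
        rw [hc] at hs
        simp [iotaMap, actF0, tensF0, h]
        rw [dif_pos h.le, hs]
        refine alg_f0 hη ?_ ?_ <;> (simp only [← exp_add]; congr 1; ring)
      · obtain rfl : j = K := by omega
        simp [iotaMap, actF0, tensF0]
        have e : exp (η * j / 2) * exp x = exp (-(2 * η * ((j : ℂ) / 2 - j))) * exp (x - (j : ℂ) / 2 * η) := by simp only [← exp_add]; congr 1; ring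
        field_simp at e ⊢
        linear_combination (sinh (η * (j + 1)) * f ⟨j + 1, by omega⟩) * e
    · by_cases h : j < K
      · simp [iotaMap, actF0, tensF0, h]
        have e : exp (η * ((K : ℂ) - j) / 2) * exp x = exp (x + η / 2) * exp (η * ((K : ℂ) - (j + 1)) / 2) := by simp only [← exp_add]; congr 1; ring
        linear_combination (sinh ((j + 1) * η) / sinh η * (sinh ((j + 1 + 1) * η)
          * sinh ((K - j) * η) / sinh η ^ 2) * f ⟨j + 1 + 1, by omega⟩) * e
      · obtain rfl : j = K := by omega
        simp [iotaMap, actF0, tensF0]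
  · intro lam f
    funext ⟨a, j, hj⟩
    fin_cases a
    · simp [iotaMap, actH1, tensH1]
      have e : exp (2 * lam * η * (((K : ℂ) + 1) / 2 - j))
          = exp (2 * lam * η * 2⁻¹) * exp (2 * lam * η * ((K : ℂ) / 2 - j)) := by simp only [← exp_add]; congr 1; ring
      rw [e]
      ring
    · simp [iotaMap, actH1, tensH1]
      have e : exp (2 * lam * η * (((K : ℂ) + 1) / 2 - (j + 1)))
          = exp (2 * lam * η * (2⁻¹ - 1)) * exp (2 * lam * η * ((K : ℂ) / 2 - j)) := by simp only [← exp_add]; congr 1; ring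
      rw [e]
      ring
end

section
/- Fix η ∈ ℂ with sinh(η) ≠ 0, and let k be a nonnegative half-integer with sinh((2k+1)η) ≠ 0. Let V^k have basis v₁^k,…,v_{2k+1}^k (v₀^k = v_{2k+2}^k = 0) and V^{1/2} have basis v₁^{1/2}, v₂^{1/2}. Define the operator R^{½k}(x) on V^{1/2}⊗V^k by R^{½k}(x)(v₁⊗v_n) = [sinh(x+(3/2+k−n)η)/sinh(x+(1/2+k)η)]·v₁⊗v_n + [e^{(k+3/2−n)η}·sinh((n−1)η)·sinh((2k+2−n)η)/(sinh(η)·sinh(x+(1/2+k)η))]·v₂⊗v_{n−1} and R^{½k}(x)(v₂⊗v_n) = [e^{(n−k−1/2)η}·sinh(η)/sinh(x+(k+1/2)η)]·v₁⊗v_{n+1} + [sinh(x+(n−1/2−k)η)/sinh(x+(1/2+k)η)]·v₂⊗v_n. Let P: V^{1/2}⊗V^k → V^k⊗V^{1/2} be the flip u⊗w ↦ w⊗u, let ι^k(v_n^{k+1/2}) = e^{η(n−1)/2}·v₁⊗v_n^k + e^{−η(n−2−2k)/2}·[sinh((n−1)η)/sinh(η)]·v₂⊗v_{n−1}^k, and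 set j^k := P∘ι^k: V^{k+1/2} → V^k⊗V^{1/2}. Then the operator S^k := P∘R^{½k}((k+1/2)η) satisfies, for all 1 ≤ n ≤ 2k+1: S^k(v₁⊗v_n^k) = [sinh((2k+2−n)η)/sinh((2k+1)η)]·e^{−η(n−1)/2}·j^k(v_n^{k+1/2}) and S^k(v₂⊗v_n^k) = [sinh(η)/sinh((2k+1)η)]·e^{η(n−2k−1)/2}·j^k(v_{n+1}^{k+1/2}). -/
open Complex

/-- The finite R-operator `R^{½k}(x)` on `V^{1/2}⊗V^k` (with `k = K/2`), in
coordinates: the space is `Fin 2 × Fin (K+1) → ℂ`, index `(a,j) ↔ v_{a+1}^{1/2}⊗v_{j+1}^k`.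
It is given on the basis by
`R^{½k}(x)(v₁⊗v_n) = [sinh(x+(3/2+k−n)η)/sinh(x+(1/2+k)η)]·v₁⊗v_n
  + [e^{(k+3/2−n)η}·sinh((n−1)η)·sinh((2k+2−n)η)/(sinh(η)·sinh(x+(1/2+k)η))]·v₂⊗v_{n−1}`,
`R^{½k}(x)(v₂⊗v_n) = [e^{(n−k−1/2)η}·sinh(η)/sinh(x+(k+1/2)η)]·v₁⊗v_{n+1}
  + [sinh(x+(n−1/2−k)η)/sinh(x+(1/2+k)η)]·v₂⊗v_n`. -/
noncomputable def Rhalf (η x : ℂ) (K : ℕ) (f : Fin 2 × Fin (K + 1) → ℂ) :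
    Fin 2 × Fin (K + 1) → ℂ :=
  fun p =>
    if p.1 = 0 then
      -- coefficient of `v₁⊗v_{j+1}`: diagonal term (from `v₁⊗v_{j+1}`, i.e. `n = j+1`)
      -- plus the term coming from `v₂⊗v_j` (i.e. `n = j`, index `j−1`).
      sinh (x + (3 / 2 + (K : ℂ) / 2 - (((p.2 : ℕ) : ℂ) + 1)) * η)
          / sinh (x + (1 / 2 + (K : ℂ) / 2) * η) * f (0, p.2)
        + (if h : 0 < (p.2 : ℕ) then
            Complex.exp ((((p.2 : ℕ) : ℂ) - (K : ℂ) / 2 - 1 / 2) * η) * sinh η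
                / sinh (x + ((K : ℂ) / 2 + 1 / 2) * η)
              * f (1, ⟨(p.2 : ℕ) - 1, lt_of_le_of_lt (Nat.sub_le _ _) p.2.isLt⟩)
          else 0)
    else
      -- coefficient of `v₂⊗v_{j+1}`: diagonal term (`n = j+1`)
      -- plus the term coming from `v₁⊗v_{j+2}` (i.e. `n = j+2`, index `j+1`).
      sinh (x + ((((p.2 : ℕ) : ℂ) + 1) - 1 / 2 - (K : ℂ) / 2) * η)
          / sinh (x + (1 / 2 + (K : ℂ) / 2) * η) * f (1, p.2)
        + (if h : (p.2 : ℕ) + 1 < K + 1 then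
            Complex.exp (((K : ℂ) / 2 + 3 / 2 - (((p.2 : ℕ) : ℂ) + 2)) * η)
                * sinh ((((p.2 : ℕ) : ℂ) + 1) * η)
                * sinh ((2 * ((K : ℂ) / 2) + 2 - (((p.2 : ℕ) : ℂ) + 2)) * η)
                / (sinh η * sinh (x + (1 / 2 + (K : ℂ) / 2) * η))
              * f (0, ⟨(p.2 : ℕ) + 1, h⟩)
          else 0)

/-- The flip `P : V^{1/2}⊗V^k → V^k⊗V^{1/2}` in coordinates. -/
noncomputable def Pflip (K : ℕ) (f : Fin 2 × Fin (K + 1) → ℂ) :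
    Fin (K + 1) × Fin 2 → ℂ :=
  fun p => f (p.2, p.1)

/-- The map `j^k := P∘ι^k : V^{k+1/2} → V^k⊗V^{1/2}` in coordinates. -/
noncomputable def jMap (η : ℂ) (K : ℕ) (f : Fin (K + 2) → ℂ) :
    Fin (K + 1) × Fin 2 → ℂ :=
  Pflip K (iotaMap η K f)

/-- Standard basis vector of `V^{1/2}⊗V^k`: the vector `v_{a+1}^{1/2}⊗v_{j+1}^k`. -/
noncomputable def basVec (K : ℕ) (a : Fin 2) (j : Fin (K + 1)) :
    Fin 2 × Fin (K + 1) → ℂ :=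
  fun p => if p = (a, j) then 1 else 0

/-- Standard basis vector `v_{n+1}^{k+1/2}` of `V^{k+1/2}`. -/
noncomputable def basVec' (K : ℕ) (n : Fin (K + 2)) : Fin (K + 2) → ℂ :=
  fun m => if m = n then 1 else 0

/-- Lemma (link) of the paper: the fusion intertwiner
`S^k := P∘R^{½k}((k+1/2)η)` is explicitly given on the weight basis by
`S^k(v₁⊗v_n) = [sinh((2k+2−n)η)/sinh((2k+1)η)]·e^{−η(n−1)/2}·j^k(v_n^{k+1/2})` and
`S^k(v₂⊗v_n) = [sinh(η)/sinh((2k+1)η)]·e^{η(n−2k−1)/2}·j^k(v_{n+1}^{k+1/2})`,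
where `k = K/2` and `n = j+1` for the index `j : Fin (K+1)`. -/
theorem fusion_intertwiner_formula (η : ℂ) (hη : sinh η ≠ 0) (K : ℕ)
    (h2k1 : sinh (((K : ℂ) + 1) * η) ≠ 0) :
    ∀ j : Fin (K + 1),
      (Pflip K (Rhalf η (((K : ℂ) / 2 + 1 / 2) * η) K (basVec K 0 j))
          = (sinh (((K : ℂ) + 1 - ((j : ℕ) : ℂ)) * η) / sinh (((K : ℂ) + 1) * η)
                * Complex.exp (-(η * ((j : ℕ) : ℂ) / 2)))
              • jMap η K (basVec' K (Fin.castSucc j)))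
      ∧ (Pflip K (Rhalf η (((K : ℂ) / 2 + 1 / 2) * η) K (basVec K 1 j))
          = (sinh η / sinh (((K : ℂ) + 1) * η)
                * Complex.exp (η * (((j : ℕ) : ℂ) - (K : ℂ)) / 2))
              • jMap η K (basVec' K (Fin.succ j))) := by
  intro j
  have e1 : (((K : ℂ) / 2 + 1 / 2) * η + (1 / 2 + (K : ℂ) / 2) * η) = ((K : ℂ) + 1) * η := by ring
  have e2 : (((K : ℂ) / 2 + 1 / 2) * η + ((K : ℂ) / 2 + 1 / 2) * η) = ((K : ℂ) + 1) * η := by ring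
  constructor
  · funext ⟨m, a⟩
    fin_cases a
    · simp only [Pflip, Rhalf, jMap, iotaMap, basVec, basVec', Pi.smul_apply, smul_eq_mul, e1, e2]
      by_cases h : m = j
      · subst h
        have e3 : (((K : ℂ) / 2 + 1 / 2) * η + (3 / 2 + (K : ℂ) / 2 - (((m : ℕ) : ℂ) + 1)) * η)
          = ((K : ℂ) + 1 - ((m : ℕ) : ℂ)) * η := by ring
        have e4 : Complex.exp (-(η * ((m : ℕ) : ℂ) / 2)) * Complex.exp (η * ((m : ℕ) : ℂ) / 2) = 1 := by
          rw [← Complex.exp_add]; simp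
        rw [e3]
        simp [mul_assoc, e4]
      · simp [h]
    · simp only [Pflip, Rhalf, jMap, iotaMap, basVec, basVec', Pi.smul_apply, smul_eq_mul, e1, e2]
      by_cases h : (m : ℕ) + 1 = j
      · have hlt : (m : ℕ) + 1 < K + 1 := h ▸ j.isLt
        have hs : Fin.succ m = Fin.castSucc j := by ext; simpa using h
        have hj : (⟨(m : ℕ) + 1, hlt⟩ : Fin (K + 1)) = j := by ext; simpa using h
        have hc : ((j : ℕ) : ℂ) = ((m : ℕ) : ℂ) + 1 := by rw [← h]; push_cast; rfl
        have e3 : ((2 * ((K : ℂ) / 2) + 2 - (((m : ℕ) : ℂ) + 2)) * η)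
          = ((K : ℂ) + 1 - (((m : ℕ) : ℂ) + 1)) * η := by ring
        have e4 : Complex.exp (((K : ℂ) / 2 + 3 / 2 - (((m : ℕ) : ℂ) + 2)) * η)
          = Complex.exp (-(η * (((m : ℕ) : ℂ) + 1) / 2)) * Complex.exp (η * ((K : ℂ) - ((m : ℕ) : ℂ)) / 2) := by
          rw [← Complex.exp_add]; congr 1; ring
        rw [dif_pos hlt, hj, hs, hc, e3, e4]
        simp
        field_simp
      · have hs : ¬ Fin.succ m = Fin.castSucc j := by
          intro hh; apply h; simpa using congrArg Fin.val hh
        have hj : ∀ hlt, ¬ (⟨(m : ℕ) + 1, hlt⟩ : Fin (K + 1)) = j := by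
          intro hlt hh; apply h; simpa using congrArg Fin.val hh
        simp [hs, hj]
  · funext ⟨m, a⟩
    fin_cases a
    · simp only [Pflip, Rhalf, jMap, iotaMap, basVec, basVec', Pi.smul_apply, smul_eq_mul, e1, e2]
      by_cases h : (m : ℕ) = j + 1
      · have hlt : 0 < (m : ℕ) := by omega
        have hs : Fin.castSucc m = Fin.succ j := by ext; simpa using h
        have hj : (⟨(m : ℕ) - 1, lt_of_le_of_lt (Nat.sub_le _ _) m.isLt⟩ : Fin (K + 1)) = j := by
          ext; simp [h]
        have hc : ((m : ℕ) : ℂ) = ((j : ℕ) : ℂ) + 1 := by rw [h]; push_cast; rfl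
        have e4 : Complex.exp ((((j : ℕ) : ℂ) + 1 - (K : ℂ) / 2 - 1 / 2) * η)
          = Complex.exp (η * (((j : ℕ) : ℂ) - (K : ℂ)) / 2) * Complex.exp (η * (((j : ℕ) : ℂ) + 1) / 2) := by
          rw [← Complex.exp_add]; congr 1; ring
        rw [dif_pos hlt, hj, hs, hc, e4]
        simp
        field_simp
      · have hs : ¬ Fin.castSucc m = Fin.succ j := by
          intro hh; apply h; simpa using congrArg Fin.val hh
        have hj : 0 < (m : ℕ) →
            ¬ (⟨(m : ℕ) - 1, lt_of_le_of_lt (Nat.sub_le _ _) m.isLt⟩ : Fin (K + 1)) = j := by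
          intro hlt hh
          have := congrArg Fin.val hh
          simp only at this
          omega
        by_cases hlt : 0 < (m : ℕ)
        · rw [dif_pos hlt]
          simp [hs, hj hlt]
        · rw [dif_neg hlt]
          simp [hs]
    · simp only [Pflip, Rhalf, jMap, iotaMap, basVec, basVec', Pi.smul_apply, smul_eq_mul, e1, e2]
      by_cases h : m = j
      · subst h
        have e3 : (((K : ℂ) / 2 + 1 / 2) * η + ((((m : ℕ) : ℂ) + 1) - 1 / 2 - (K : ℂ) / 2) * η)
          = (((m : ℕ) : ℂ) + 1) * η := by ring
        have e4 : Complex.exp (η * (((m : ℕ) : ℂ) - (K : ℂ)) / 2)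
            * Complex.exp (η * ((K : ℂ) - ((m : ℕ) : ℂ)) / 2) = 1 := by
          rw [← Complex.exp_add, ← Complex.exp_zero]; congr 1; ring
        rw [e3]
        simp only [Fin.mk_one, Fin.isValue, one_ne_zero, if_false, if_true, Prod.mk.injEq]
        simp
        generalize Complex.exp (η * (((m : ℕ) : ℂ) - (K : ℂ)) / 2) = A at *
        generalize Complex.exp (η * ((K : ℂ) - ((m : ℕ) : ℂ)) / 2) = B at *
        generalize sinh ((((m : ℕ) : ℂ) + 1) * η) = C at *
        field_simp
        linear_combination (-C) * e4
      · simp [h]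
end

section
/- Let τ, η, ℓ ∈ ℂ with Re(τ) < 0 and set q = e^τ. For z ∈ ℂ let (z;q²)_∞ := ∏_{i=0}^∞ (1 − q^{2i} z), a convergent infinite product since |q| < 1. Define F^ℓ(x) := e^{2ℓηx/τ} · (q² e^{2(x+ℓη)}; q²)_∞ / (q² e^{2(x−ℓη)}; q²)_∞. Suppose q^{2i} e^{2(x−ℓη)} ≠ 1 for all integers i ≥ 1 (so the denominators at x and x+τ are nonzero). Then sinh(x+τ+ℓη)·F^ℓ(x+τ) = sinh(x+τ−ℓη)·F^ℓ(x). -/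
open Complex

/-- The q-shifted factorial `(z;q)_∞ := ∏_{i=0}^∞ (1 − qⁱ z)`. -/
noncomputable def qpoch (z q : ℂ) : ℂ := ∏' i : ℕ, (1 - q ^ i * z)

/-- The one-point weight factor (wghtexplicit):
`F^ℓ(x) = e^{2ℓηx/τ} · (q² e^{2(x+ℓη)}; q²)_∞ / (q² e^{2(x−ℓη)}; q²)_∞`, with `q = e^τ`. -/
noncomputable def Fweight (τ η ℓ x : ℂ) : ℂ :=
  Complex.exp (2 * ℓ * η * x / τ)
    * qpoch (Complex.exp τ ^ 2 * Complex.exp (2 * (x + ℓ * η))) (Complex.exp τ ^ 2)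
    / qpoch (Complex.exp τ ^ 2 * Complex.exp (2 * (x - ℓ * η))) (Complex.exp τ ^ 2)

theorem qpoch_shift (z q : ℂ) (hq : ‖q‖ < 1) : qpoch z q = (1 - z) * qpoch (q * z) q := by
  have hs : Summable fun i : ℕ => ‖-(q ^ (i + 1) * z)‖ := by
    have h : Summable fun i : ℕ => ‖q‖ ^ i * (‖q‖ * ‖z‖) :=
      (summable_geometric_of_lt_one (norm_nonneg q) hq).mul_right _
    refine h.congr fun i => ?_
    rw [norm_neg, norm_mul, norm_pow]
    ring
  have hm : Multipliable fun i : ℕ => (1 - q ^ (i + 1) * z) := by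
    have h := multipliable_one_add_of_summable (f := fun i : ℕ => -(q ^ (i + 1) * z)) hs
    simp only [← sub_eq_add_neg] at h
    exact h
  have h0 : ∏' i : ℕ, (1 - q ^ i * z)
      = (1 - q ^ 0 * z) * ∏' i : ℕ, (1 - q ^ (i + 1) * z) :=
    tprod_eq_zero_mul' (f := fun i : ℕ => 1 - q ^ i * z) hm
  have h1 : ∀ i : ℕ, 1 - q ^ i * (q * z) = 1 - q ^ (i + 1) * z := fun i => by
    rw [pow_succ, mul_assoc]
  unfold qpoch
  simp only [h1]
  rw [h0, pow_zero, one_mul]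

theorem sinh_factor (y : ℂ) : sinh y = -(1 / 2) * exp (-y) * (1 - exp (2 * y)) := by
  have h : exp (2 * y) = exp y * exp y := by rw [← Complex.exp_add]; ring_nf
  have h2 : exp (-y) * exp y = 1 := by rw [← Complex.exp_add]; simp
  rw [Complex.sinh, h]
  linear_combination (-(1 / 2) * exp y) * h2

/-- The q-difference (functional) equation
`F^ℓ(x+τ) = [sinh(x+τ−ℓη)/sinh(x+τ+ℓη)]·F^ℓ(x)` for the explicit weight factor,
in cleared-denominator form. -/
theorem Fweight_functional_equation (τ η ℓ x : ℂ) (hτ : τ.re < 0)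
    (hden : ∀ i : ℕ, 1 ≤ i → Complex.exp τ ^ (2 * i) * Complex.exp (2 * (x - ℓ * η)) ≠ 1) :
    sinh (x + τ + ℓ * η) * Fweight τ η ℓ (x + τ)
      = sinh (x + τ - ℓ * η) * Fweight τ η ℓ x := by
  have hτ0 : τ ≠ 0 := by
    rintro rfl
    simp at hτ
  have hq : ‖exp τ ^ 2‖ < 1 := by
    rw [norm_pow, Complex.norm_exp]
    exact pow_lt_one₀ (Real.exp_pos _).le (Real.exp_lt_one_iff.mpr hτ) two_ne_zero
  have hs : ∀ b : ℂ, exp τ ^ 2 * exp (2 * (x + b)) = exp (2 * (x + τ + b)) := by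
    intro b
    rw [← Complex.exp_nat_mul, ← Complex.exp_add]
    congr 1
    push_cast
    ring
  have hs2 : ∀ b : ℂ, exp (2 * (x + τ + b)) = exp τ ^ 2 * exp (2 * (x + b)) := fun b => (hs b).symm
  have hc : 1 - exp (2 * (x + τ + -(ℓ * η))) ≠ 0 := by
    rw [← hs, ← sub_eq_add_neg]
    exact sub_ne_zero.mpr (by simpa using (hden 1 le_rfl).symm)
  have he : exp (2 * ℓ * η * (x + τ) / τ) = exp (2 * ℓ * η * x / τ) * exp (2 * (ℓ * η)) := by
    rw [← Complex.exp_add]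
    congr 1
    field_simp
  have hb : exp (-(x + τ + ℓ * η)) * exp (2 * (ℓ * η)) = exp (-(x + τ + -(ℓ * η))) := by
    rw [← Complex.exp_add]
    congr 1
    ring
  unfold Fweight
  simp only [sub_eq_add_neg (x + τ), sub_eq_add_neg x]
  rw [hs (ℓ * η), hs (-(ℓ * η)), qpoch_shift (exp (2 * (x + τ + ℓ * η))) _ hq,
    qpoch_shift (exp (2 * (x + τ + -(ℓ * η)))) _ hq, he, sinh_factor (x + τ + ℓ * η),
    sinh_factor (x + τ + -(ℓ * η)), ← hb]
  generalize qpoch _ _ = A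
  generalize qpoch _ _ = C
  by_cases hC : C = 0
  · simp [hC]
  · field_simp
end

section
/- Let τ, η, ξ₊, ξ₋ ∈ ℂ and let g, h: ℂ → ℂ be functions satisfying, for all x ∈ ℂ, the cleared-denominator functional equations sinh(ξ₋+x+τ−η/2)·sinh(ξ₊+x+τ/2−η/2)·g(x+τ) = sinh(ξ₋−x−η/2)·sinh(ξ₊−x−τ/2−η/2)·g(x) and sinh(x)·sinh(x+τ−η)·h(x+τ) = sinh(x+τ)·sinh(x+η)·h(x). For S ≥ 1 and x = (x₁,…,x_S) ∈ ℂ^S define G(x) := (∏_{i=1}^S g(x_i)) · ∏_{1≤i<i'≤S} h(x_i+x_{i'})·h(x_i−x_{i'}). Then for every i ∈ {1,…,S} and every x ∈ ℂ^S the following cleared-denominator identity holds: sinh(ξ₋−x_i+τ−η/2)·sinh(ξ₊−x_i+τ/2−η/2)·(∏_{i'≠i} sinh(x_i+x_{i'}−τ+η)·sinh(x_i−x_{i'}−τ+η)·sinh(x_i+x_{i'})·sinh(x_i−x_{i'}))·G(x−τe_i) = sinh(ξ₋+x_i−η/2)·sinh(ξ₊+x_i−τ/2−η/2)·(∏_{i'≠i}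 sinh(x_i+x_{i'}−τ)·sinh(x_i−x_{i'}−τ)·sinh(x_i+x_{i'}−η)·sinh(x_i−x_{i'}−η))·G(x), where x−τe_i denotes x with its i-th coordinate decreased by τ. -/
open Complex Finset

/-- The `t`-independent part of the weight function:
`G(x) = (∏_{i=1}^S g(x_i)) · ∏_{1≤i<i'≤S} h(x_i+x_{i'})·h(x_i−x_{i'})`. -/
noncomputable def Gweight (g h : ℂ → ℂ) {S : ℕ} (x : Fin S → ℂ) : ℂ :=
  (∏ i, g (x i))
    * ∏ p ∈ Finset.univ.filter (fun p : Fin S × Fin S => p.1 < p.2),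
        h (x p.1 + x p.2) * h (x p.1 - x p.2)

theorem pair_split {S : ℕ} (f : Fin S × Fin S → ℂ) (i : Fin S) :
    ∏ p ∈ Finset.univ.filter (fun p : Fin S × Fin S => p.1 < p.2), f p
      = (∏ j ∈ Finset.univ.erase i, f (if i < j then (i, j) else (j, i)))
        * ∏ p ∈ (Finset.univ.filter (fun p : Fin S × Fin S => p.1 < p.2)).filter
            (fun p => ¬ (p.1 = i ∨ p.2 = i)), f p := by
  rw [← Finset.prod_filter_mul_prod_filter_not _
    (fun p : Fin S × Fin S => p.1 = i ∨ p.2 = i) f]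
  congr 1
  symm
  refine Finset.prod_bij' (fun j _ => if i < j then (i, j) else (j, i))
    (fun p _ => if p.1 = i then p.2 else p.1) ?_ ?_ ?_ ?_ ?_
  · intro j hj
    simp only [Finset.mem_erase, Finset.mem_univ, and_true] at hj
    by_cases h : i < j
    · simp [h]
    · have : j < i := lt_of_le_of_ne (not_lt.mp h) hj
      simp [h, this]
  · rintro ⟨a, b⟩ hp
    simp only [Finset.mem_filter, Finset.mem_univ, true_and] at hp
    simp only [Finset.mem_erase, Finset.mem_univ, and_true]
    split_ifs with h
    · exact h ▸ hp.1.ne'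
    · exact h
  · intro j hj
    simp only [Finset.mem_erase, Finset.mem_univ, and_true] at hj
    by_cases h : i < j
    · simp [h]
    · simp [h, hj]
  · rintro ⟨a, b⟩ hp
    simp only [Finset.mem_filter, Finset.mem_univ, true_and] at hp
    obtain ⟨hab, h⟩ := hp
    by_cases h1 : a = i
    · subst h1; simp [hab]
    · have h2 : b = i := by tauto
      subst h2; simp [h1, not_lt.mpr hab.le]
  · intro j _; rfl

/-- The step relation (Gstep) for the `t`-independent part of the weight function
in the Jackson integral solutions of the boundary qKZ equations: it holds in
cleared-denominator form whenever `G` has the above product form with `g` and `h`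
solving their functional equations. -/
theorem Gweight_step (τ η ξp ξm : ℂ) (g h : ℂ → ℂ)
    (hg : ∀ x : ℂ,
      sinh (ξm + x + τ - η / 2) * sinh (ξp + x + τ / 2 - η / 2) * g (x + τ)
        = sinh (ξm - x - η / 2) * sinh (ξp - x - τ / 2 - η / 2) * g x)
    (hh : ∀ x : ℂ,
      sinh x * sinh (x + τ - η) * h (x + τ) = sinh (x + τ) * sinh (x + η) * h x)
    (S : ℕ) (hS : 1 ≤ S) (x : Fin S → ℂ) (i : Fin S) :
    sinh (ξm - x i + τ - η / 2) * sinh (ξp - x i + τ / 2 - η / 2)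
        * (∏ i' ∈ Finset.univ.erase i,
            sinh (x i + x i' - τ + η) * sinh (x i - x i' - τ + η)
              * sinh (x i + x i') * sinh (x i - x i'))
        * Gweight g h (Function.update x i (x i - τ))
      = sinh (ξm + x i - η / 2) * sinh (ξp + x i - τ / 2 - η / 2)
        * (∏ i' ∈ Finset.univ.erase i,
            sinh (x i + x i' - τ) * sinh (x i - x i' - τ)
              * sinh (x i + x i' - η) * sinh (x i - x i' - η))
        * Gweight g h x := by
  have hG : ∀ y : Fin S → ℂ, Gweight g h y = (g (y i) * ∏ j ∈ Finset.univ.erase i, g (y j))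
      * ((∏ j ∈ Finset.univ.erase i,
          h (y i + y j) * (if i < j then h (y i - y j) else h (y j - y i)))
        * ∏ p ∈ (Finset.univ.filter (fun p : Fin S × Fin S => p.1 < p.2)).filter
            (fun p => ¬ (p.1 = i ∨ p.2 = i)), h (y p.1 + y p.2) * h (y p.1 - y p.2)) := by
    intro y
    unfold Gweight
    rw [pair_split _ i, Finset.mul_prod_erase _ (fun j => g (y j)) (Finset.mem_univ i)]
    congr 2
    refine Finset.prod_congr rfl fun j _ => ?_
    split_ifs
    · rfl
    · simp [add_comm]
  have hG2 : Gweight g h (Function.update x i (x i - τ)) =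
      (g (x i - τ) * ∏ j ∈ Finset.univ.erase i, g (x j))
      * ((∏ j ∈ Finset.univ.erase i,
          h (x i - τ + x j) * (if i < j then h (x i - τ - x j) else h (x j - (x i - τ))))
        * ∏ p ∈ (Finset.univ.filter (fun p : Fin S × Fin S => p.1 < p.2)).filter
            (fun p => ¬ (p.1 = i ∨ p.2 = i)), h (x p.1 + x p.2) * h (x p.1 - x p.2)) := by
    rw [hG]
    congr 1
    · congr 1
      · simp
      · refine Finset.prod_congr rfl fun j hj => ?_
        rw [Function.update_of_ne (Finset.ne_of_mem_erase hj)]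
    · congr 1
      · refine Finset.prod_congr rfl fun j hj => ?_
        rw [Function.update_of_ne (Finset.ne_of_mem_erase hj), Function.update_self]
      · refine Finset.prod_congr rfl fun p hp => ?_
        have hp2 := (Finset.mem_filter.mp hp).2
        rw [not_or] at hp2
        rw [Function.update_of_ne hp2.1, Function.update_of_ne hp2.2]
  have key : (∏ i' ∈ Finset.univ.erase i,
            sinh (x i + x i' - τ + η) * sinh (x i - x i' - τ + η)
              * sinh (x i + x i') * sinh (x i - x i'))
      * (∏ j ∈ Finset.univ.erase i,
          h (x i - τ + x j) * (if i < j then h (x i - τ - x j) else h (x j - (x i - τ))))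
      = (∏ i' ∈ Finset.univ.erase i,
            sinh (x i + x i' - τ) * sinh (x i - x i' - τ)
              * sinh (x i + x i' - η) * sinh (x i - x i' - η))
      * (∏ j ∈ Finset.univ.erase i,
          h (x i + x j) * (if i < j then h (x i - x j) else h (x j - x i))) := by
    rw [← Finset.prod_mul_distrib, ← Finset.prod_mul_distrib]
    refine Finset.prod_congr rfl fun j _ => ?_
    have hs : ∀ y : ℂ, sinh (y - τ + η) * sinh y * h (y - τ)
        = sinh (y - τ) * sinh (y - η) * h y := by
      intro y
      have := hh (y - τ)
      rw [show y - τ + τ - η = y - η by ring, show y - τ + τ = y by ring] at this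
      linear_combination -this
    have h1 := hs (x i + x j)
    have h2 : sinh (x i - x j - τ + η) * sinh (x i - x j)
          * (if i < j then h (x i - τ - x j) else h (x j - (x i - τ)))
        = sinh (x i - x j - τ) * sinh (x i - x j - η)
          * (if i < j then h (x i - x j) else h (x j - x i)) := by
      split_ifs
      · have := hs (x i - x j)
        rwa [show x i - x j - τ = x i - τ - x j by ring] at this ⊢
      · have := hh (x j - x i)
        rw [show x i - x j - τ + η = -(x j - x i + τ - η) by ring,
          show x i - x j - τ = -(x j - x i + τ) by ring,
          show x i - x j - η = -(x j - x i + η) by ring,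
          show x i - x j = -(x j - x i) by ring,
          show x j - (x i - τ) = x j - x i + τ by ring]
        simp only [sinh_neg]
        linear_combination this
    rw [show x i - τ + x j = x i + x j - τ by ring]
    generalize (if i < j then h (x i - τ - x j) else h (x j - (x i - τ))) = A at *
    generalize (if i < j then h (x i - x j) else h (x j - x i)) = B at *
    linear_combination (sinh (x i - x j - τ + η) * sinh (x i - x j) * A) * h1
      + (sinh (x i + x j - τ) * sinh (x i + x j - η) * h (x i + x j)) * h2
  have hg1 := hg (x i - τ)
  rw [show ξm + (x i - τ) + τ - η / 2 = ξm + x i - η / 2 by ring,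
    show ξp + (x i - τ) + τ / 2 - η / 2 = ξp + x i - τ / 2 - η / 2 by ring,
    show ξm - (x i - τ) - η / 2 = ξm - x i + τ - η / 2 by ring,
    show ξp - (x i - τ) - τ / 2 - η / 2 = ξp - x i + τ / 2 - η / 2 by ring,
    show x i - τ + τ = x i by ring] at hg1
  rw [hG2, hG x]
  generalize (∏ j ∈ Finset.univ.erase i, g (x j)) = P at *
  generalize (∏ p ∈ (Finset.univ.filter (fun p : Fin S × Fin S => p.1 < p.2)).filter
            (fun p => ¬ (p.1 = i ∨ p.2 = i)), h (x p.1 + x p.2) * h (x p.1 - x p.2)) = Q at *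
  generalize (∏ i' ∈ Finset.univ.erase i,
            sinh (x i + x i' - τ + η) * sinh (x i - x i' - τ + η)
              * sinh (x i + x i') * sinh (x i - x i')) = A at *
  generalize (∏ i' ∈ Finset.univ.erase i,
            sinh (x i + x i' - τ) * sinh (x i - x i' - τ)
              * sinh (x i + x i' - η) * sinh (x i - x i' - η)) = B at *
  generalize (∏ j ∈ Finset.univ.erase i,
          h (x i - τ + x j) * (if i < j then h (x i - τ - x j) else h (x j - (x i - τ)))) = C at *
  generalize (∏ j ∈ Finset.univ.erase i,
          h (x i + x j) * (if i < j then h (x i - x j) else h (x j - x i))) = D at *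
  linear_combination (-(A * C * P * Q)) * hg1
    + (sinh (ξm + x i - η / 2) * sinh (ξp + x i - τ / 2 - η / 2) * g (x i) * P * Q) * key
end
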